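/- arXiv:2010.05901 — 4 statements merged into one kernel-verified Lean document; each statement's English description precedes it below -/
import Mathlib

section
/- Let n ≥ 2 be an integer, let Z₁, …, Zₙ be i.i.d. random variables with values in [0,1], and let δ > 0. Set Z̄ = (1/n)·Σᵢ Zᵢ and V̂ₙ = (1/n)·Σᵢ (Zᵢ − Z̄)². Then ℙ( |𝔼[Z₁] − Z̄| > √( 2·V̂ₙ·ln(2/δ) / (n−1) ) + 7·ln(2/δ) / (3(n−1)) ) ≤ δ. -/
open MeasureTheory ProbabilityTheory

lemma eb_bern_pt {M l x : ℝ} (hl : 0 ≤ l) (hM : 0 ≤ M) (hlM : l * M ≤ 1) (hx : |x| ≤ M) :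
    Real.exp (l * x) ≤ 1 + l * x + l ^ 2 / (2 * (1 - l * M / 3)) * x ^ 2 := by
  have hu : |l * x| ≤ l * M := by
    rw [abs_mul, abs_of_nonneg hl]; exact mul_le_mul_of_nonneg_left hx hl
  have hb := Real.exp_bound (x := l * x) (hu.trans hlM) (n := 4) (by norm_num)
  simp [Finset.sum_range_succ, Nat.factorial, -abs_mul] at hb
  have hb2 := (abs_le.mp hb).2
  set u := l * x with hu_def
  set c := l * M with hc
  have hc0 : 0 ≤ c := by positivity
  have e1 : l ^ 2 / (2 * (1 - c / 3)) * x ^ 2 = u ^ 2 / 2 * (1 / (1 - c / 3)) := by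
    have : (1 - c / 3) ≠ 0 := by linarith
    rw [hu_def]; field_simp
  rw [e1]
  have e2 : 1 + c / 3 + c ^ 2 / 9 ≤ 1 / (1 - c / 3) := by
    rw [le_div_iff₀ (by linarith)]
    nlinarith [pow_nonneg hc0 3]
  have e3 : u ^ 2 / 2 * (1 + c / 3 + c ^ 2 / 9) ≤ u ^ 2 / 2 * (1 / (1 - c / 3)) :=
    mul_le_mul_of_nonneg_left e2 (by positivity)
  have h3 : u ^ 3 ≤ u ^ 2 * c := by
    have : u ≤ c := (le_abs_self u).trans hu
    nlinarith [sq_nonneg u]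
  have h4 : |u| ^ 4 ≤ u ^ 2 * c ^ 2 := by
    have : u ^ 2 ≤ c ^ 2 := by rw [← sq_abs]; exact pow_le_pow_left₀ (abs_nonneg _) hu 2
    have e : |u| ^ 4 = u ^ 2 * u ^ 2 := by rw [← sq_abs u]; ring
    rw [e]; exact mul_le_mul_of_nonneg_left this (by positivity)
  have h5 : 0 ≤ u ^ 2 * c ^ 2 := by positivity
  nlinarith

lemma eb_regA_pt {x : ℝ} (hx : |x| ≤ 1) :
    Real.exp (0.76 * x) ≤ 1 + 0.76 * x + 0.3789 * x ^ 2 := by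
  have hu : |0.76 * x| ≤ 0.76 := by
    rw [abs_mul]; norm_num; linarith
  have hb := Real.exp_bound (x := 0.76 * x) (hu.trans (by norm_num)) (n := 5) (by norm_num)
  simp [Finset.sum_range_succ, Nat.factorial] at hb
  have hb2 := (abs_le.mp hb).2
  have e : |0.76 * x| ^ 5 ≤ 0.76 ^ 5 * x ^ 2 := by
    rw [abs_mul, mul_pow]
    norm_num [abs_of_pos]
    have h3 : |x| ^ 3 ≤ 1 := pow_le_one₀ (abs_nonneg _) hx
    calc |x| ^ 5 = |x| ^ 3 * x ^ 2 := by rw [← sq_abs x]; ring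
      _ ≤ 1 * x ^ 2 := mul_le_mul_of_nonneg_right h3 (by positivity)
      _ = x ^ 2 := one_mul _
  have h3 : x ^ 3 ≤ x ^ 2 := by
    have : x ≤ 1 := (le_abs_self x).trans hx
    nlinarith [sq_nonneg x]
  have h4 : x ^ 4 ≤ x ^ 2 := by
    have : x ^ 2 ≤ 1 := by rw [← sq_abs]; exact pow_le_one₀ (abs_nonneg _) hx
    nlinarith [sq_nonneg x]
  norm_num at *
  nlinarith [sq_nonneg x]

/-- chord bound -/
lemma eb_chord {u k z : ℝ} (hk : Real.exp (-u) ≤ 1 - k) (hz0 : 0 ≤ z) (hz1 : z ≤ 1) :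
    Real.exp (-(u * z)) ≤ 1 - k * z := by
  have := convexOn_exp.2 (Set.mem_univ (0:ℝ)) (Set.mem_univ (-u)) (by linarith : 0 ≤ 1 - z) hz0 (by ring)
  simp only [smul_eq_mul, mul_zero, zero_add, Real.exp_zero, mul_one] at this
  have e : -(u * z) = z * -u := by ring
  rw [e]
  nlinarith [mul_le_mul_of_nonneg_left hk hz0]

lemma eb_quad {y : ℝ} (hy : 0 ≤ y) : Real.exp (-y) ≤ 1 - y + y ^ 2 / 2 := by
  have h := Real.quadratic_le_exp_of_nonneg hy
  rw [Real.exp_neg]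
  rw [inv_le_iff_one_le_mul₀ (Real.exp_pos _)]
  have h2 : 0 ≤ 1 - y + y ^ 2 / 2 := by nlinarith [sq_nonneg (y - 1)]
  nlinarith [mul_le_mul_of_nonneg_left h h2, sq_nonneg (y^2)]

lemma eb_conc {A B C r0 r1 r : ℝ} (hC : 0 ≤ C) (h0 : r0 ≤ r) (h1 : r ≤ r1) (h01 : r0 < r1)
    (q0 : 0 ≤ A + B * r0 - C * r0 ^ 2) (q1 : 0 ≤ A + B * r1 - C * r1 ^ 2) :
    0 ≤ A + B * r - C * r ^ 2 := by
  have e : (r1 - r0) * (A + B * r - C * r ^ 2) = (r1 - r) * (A + B * r0 - C * r0 ^ 2)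
    + (r - r0) * (A + B * r1 - C * r1 ^ 2) + C * ((r - r0) * (r1 - r)) * (r1 - r0) := by ring
  have : 0 ≤ (r1 - r0) * (A + B * r - C * r ^ 2) := by
    rw [e]
    have a1 : 0 ≤ r1 - r := by linarith
    have a2 : 0 ≤ r - r0 := by linarith
    have a3 : 0 ≤ r1 - r0 := by linarith
    positivity
  exact nonneg_of_mul_nonneg_right this (by linarith)

/-- `N(r,M,y)` -/
noncomputable def ebN (r M y : ℝ) : ℝ :=
  (2 * y + (M * y ^ 2 - 7) * r / 3) ^ 2 + M * (1 - M) * r ^ 2 * (2 * y + M * y ^ 2 * r / 3) ^ 2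

lemma ebN_small {r M : ℝ} (h0 : 0 ≤ r) (h1 : r ≤ 1 / 2) (hM0 : 1 / 2 ≤ M) (hM1 : M ≤ 1) :
    ebN r M 1 ≤ 4 * (1 - 1.42 * M * r) := by
  unfold ebN
  have k1 : (2 + M * r / 3) ^ 2 ≤ (13 / 6) ^ 2 := by
    apply pow_le_pow_left₀ (by positivity); nlinarith
  have k2 : M * (1 - M) * r ^ 2 * (2 + M * r / 3) ^ 2 ≤ M * (1 - M) * r ^ 2 * (13 / 6) ^ 2 :=
    mul_le_mul_of_nonneg_left k1 (by have : 0 ≤ 1 - M := by linarith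
                                     positivity)
  have key : 0 ≤ (28 - 4 * M) / 3 - 5.68 * M - r * ((7 - M) ^ 2 / 9 + M * (1 - M) * (13 / 6) ^ 2) := by
    have : r * ((7 - M) ^ 2 / 9 + M * (1 - M) * (13 / 6) ^ 2) ≤ (1 / 2) * ((7 - M) ^ 2 / 9 + M * (1 - M) * (13 / 6) ^ 2) :=
      mul_le_mul_of_nonneg_right h1 (by have : 0 ≤ 1 - M := by linarith
                                        positivity)
    nlinarith
  have := mul_nonneg h0 key
  nlinarith

lemma ebN_mid {r M : ℝ} (h0 : 0.5 ≤ r) (h1 : r ≤ 0.88) (hM0 : 1 / 2 ≤ M) (hM1 : M ≤ 1) :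
    r ^ 2 * M ^ 2 ≤ 0.8646 - ebN r M 1 / 2 := by
  unfold ebN
  have hr : 0 ≤ r := by linarith
  have hM : 0 ≤ 1 - M := by linarith
  have k1 : (2 + M * r / 3) ^ 2 ≤ (2 + M * 0.88 / 3) ^ 2 := by
    apply pow_le_pow_left₀ (by positivity); nlinarith
  have k2 : M * (1 - M) * r ^ 2 * (2 + M * r / 3) ^ 2 ≤ M * (1 - M) * r ^ 2 * (2 + M * 0.88 / 3) ^ 2 :=
    mul_le_mul_of_nonneg_left k1 (by positivity)
  have := eb_conc (A := 0.8646 - 2) (B := 2 * (7 - M) / 3)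
    (C := (7 - M) ^ 2 / 18 + M * (1 - M) * (2 + M * 0.88 / 3) ^ 2 / 2 + M ^ 2)
    (by positivity) h0 h1 (by norm_num) ?_ ?_
  · nlinarith
  · nlinarith [mul_nonneg hM (sub_nonneg.2 hM0), mul_nonneg (mul_nonneg hM (sub_nonneg.2 hM0)) (by linarith : 0 ≤ M), mul_nonneg (mul_nonneg hM (sub_nonneg.2 hM0)) (sq_nonneg M)]
  · nlinarith [mul_nonneg hM (sub_nonneg.2 hM0), mul_nonneg (mul_nonneg hM (sub_nonneg.2 hM0)) (by linarith : 0 ≤ M), mul_nonneg (mul_nonneg hM (sub_nonneg.2 hM0)) (sq_nonneg M), sq_nonneg (M - 0.9), sq_nonneg (M * (M - 0.9))]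

lemma ebN_B2 {r M : ℝ} (h0 : 0.88 ≤ r) (h1 : r ≤ 0.99) (hM0 : 1 / 2 ≤ M) (hM1 : M ≤ 1) :
    1.35 * (r ^ 2 * M ^ 2) ≤ 2 * (0.7768 - 0.375 * ebN r M 1.06) := by
  unfold ebN
  have hr : 0 ≤ r := by linarith
  have hM : 0 ≤ 1 - M := by linarith
  have k1 : (2 * 1.06 + M * 1.06 ^ 2 * r / 3) ^ 2 ≤ (2 * 1.06 + M * 1.06 ^ 2 * 0.99 / 3) ^ 2 := by
    apply pow_le_pow_left₀ (by positivity); nlinarith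
  have k2 : M * (1 - M) * r ^ 2 * (2 * 1.06 + M * 1.06 ^ 2 * r / 3) ^ 2 ≤ M * (1 - M) * r ^ 2 * (2 * 1.06 + M * 1.06 ^ 2 * 0.99 / 3) ^ 2 :=
    mul_le_mul_of_nonneg_left k1 (by positivity)
  have := eb_conc (A := 2 * 0.7768 - 0.75 * (2 * 1.06) ^ 2) (B := 0.75 * (4 * 1.06 * (7 - M * 1.06 ^ 2) / 3))
    (C := 0.75 * (7 - M * 1.06 ^ 2) ^ 2 / 9 + 0.75 * (M * (1 - M) * (2 * 1.06 + M * 1.06 ^ 2 * 0.99 / 3) ^ 2) + 1.35 * M ^ 2)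
    (by positivity) h0 h1 (by norm_num) ?_ ?_
  · nlinarith
  · nlinarith [mul_nonneg hM (sub_nonneg.2 hM0), mul_nonneg (mul_nonneg hM (sub_nonneg.2 hM0)) (by linarith : 0 ≤ M), mul_nonneg (mul_nonneg hM (sub_nonneg.2 hM0)) (sq_nonneg M)]
  · nlinarith [mul_nonneg hM (sub_nonneg.2 hM0), mul_nonneg (mul_nonneg hM (sub_nonneg.2 hM0)) (by linarith : 0 ≤ M), mul_nonneg (mul_nonneg hM (sub_nonneg.2 hM0)) (sq_nonneg M), sq_nonneg (M - 0.79), sq_nonneg (M * (M - 0.79))]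

lemma eb_n1 {L : ℝ} (h0 : 0.6931 ≤ L) (h1 : L ≤ 1.4) :
    1 / (2 * L) + Real.exp (-(2 * L)) ≤ 2 * Real.exp (-L) := by
  have e : Real.exp (-(2 * L)) = Real.exp (-L) ^ 2 := by rw [← Real.exp_nat_mul]; congr 1; push_cast; ring
  rw [e]
  set q := Real.exp (-L) with hq
  have hq1 : q ≤ 1 := by rw [hq, Real.exp_le_one_iff]; linarith
  have hqt : 0.3678 * (2 - L) ≤ q := by
    have a : Real.exp (-L) = Real.exp (-1) * Real.exp (1 - L) := by rw [← Real.exp_add]; congr 1; ring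
    have b := Real.add_one_le_exp (1 - L)
    have c : (0.3678 : ℝ) ≤ Real.exp (-1) := by
      have := Real.exp_neg_one_gt_d9; linarith
    rw [hq, a]
    have := mul_le_mul c b (by linarith) (Real.exp_pos _).le
    linarith
  have h2 : 0.3678 * (2 - L) * (2 - 0.3678 * (2 - L)) ≤ q * (2 - q) := by nlinarith
  have h3 : 1 / (2 * L) ≤ 0.3678 * (2 - L) * (2 - 0.3678 * (2 - L)) := by
    rw [div_le_iff₀ (by linarith)]
    nlinarith [mul_nonneg (sub_nonneg.2 h0) (sub_nonneg.2 h1), mul_nonneg (mul_nonneg (sub_nonneg.2 h0) (sub_nonneg.2 h1)) (by linarith : 0 ≤ L)]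
  linarith

lemma eb_exp_bd {x : ℝ} (hx : 0 ≤ x) : Real.exp (-x) ≤ 1 / (1 + x + x ^ 2 / 2 + x ^ 3 / 6) := by
  rw [Real.exp_neg, ← one_div]
  apply one_div_le_one_div_of_le (by positivity)
  have := Real.sum_le_exp_of_nonneg hx 4
  simpa [Finset.sum_range_succ, Nat.factorial] using this

lemma eb_n2 {L a : ℝ} (h0 : 1.4 ≤ L) (ha : 0 < a) (haL : a ≤ L) :
    (Real.exp a - 1) / (Real.cosh (L + a) - 1) + Real.exp (-(2 * L)) ≤ 2 * Real.exp (-L) := by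
  have e : Real.exp (-(2 * L)) = Real.exp (-L) ^ 2 := by rw [← Real.exp_nat_mul]; congr 1; push_cast; ring
  rw [e]
  set q := Real.exp (-L) with hq
  set p := Real.exp a with hp
  have hq0 : 0 < q := Real.exp_pos _
  have hp1 : 1 < p := by rw [hp]; exact Real.one_lt_exp_iff.2 ha
  have hpq : p * q ≤ 1 := by
    rw [hp, hq, ← Real.exp_add, Real.exp_le_one_iff]; linarith
  have hq2 : q ≤ 0.28 := by
    have : Real.exp (-L) ≤ Real.exp (-1.4) := Real.exp_le_exp.2 (by linarith)
    have h := eb_exp_bd (x := 1.4) (by norm_num)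
    refine this.trans (h.trans ?_)
    norm_num
  have hc : (p / q - 2) / 2 ≤ Real.cosh (L + a) - 1 := by
    rw [Real.cosh_eq]
    have : Real.exp (L + a) = p / q := by
      rw [hp, hq, Real.exp_neg, div_inv_eq_mul, ← Real.exp_add]; congr 1; ring
    have h2 := Real.exp_pos (-(L + a))
    linarith
  have hpq2 : 2 < p / q := by rw [lt_div_iff₀ hq0]; nlinarith
  have h1 : (p - 1) / (Real.cosh (L + a) - 1) ≤ (p - 1) / ((p / q - 2) / 2) :=
    div_le_div_of_nonneg_left (by linarith) (by linarith) hc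
  have h2 : (p - 1) / ((p / q - 2) / 2) ≤ 2 * q - q ^ 2 := by
    rw [div_le_iff₀ (by linarith)]
    have : (2 * q - q ^ 2) * ((p / q - 2) / 2) = (2 - q) * (p - 2 * q) / 2 := by field_simp
    rw [this]
    nlinarith
  linarith

lemma eb_n3 {L : ℝ} (h0 : 0.6931 ≤ L) (h1 : L ≤ 2.2) : 0.4744 / L ≤ 2 * Real.exp (-L) := by
  rw [div_le_iff₀ (by linarith)]
  have c : (0.3678 : ℝ) ≤ Real.exp (-1) := by
      have := Real.exp_neg_one_gt_d9; linarith
  by_cases hL : L ≤ 1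
  · have : Real.exp (-1) ≤ Real.exp (-L) := Real.exp_le_exp.2 (by linarith)
    nlinarith
  · push Not at hL
    have a : Real.exp (-L) = Real.exp (-1) ^ 2 * Real.exp (2 - L) := by
      rw [← Real.exp_nat_mul, ← Real.exp_add]; congr 1; push_cast; ring
    have b := Real.add_one_le_exp (2 - L)
    have c3 : (0.3678794 : ℝ) ≤ Real.exp (-1) := by
      have := Real.exp_neg_one_gt_d9; linarith
    have c2 : (0.1353 : ℝ) ≤ Real.exp (-1) ^ 2 := by nlinarith
    have := mul_le_mul c2 b (by linarith) (by positivity)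
    rw [← a] at this
    nlinarith

lemma eb_n4 {L : ℝ} (h0 : 2.2 ≤ L) :
    2 * Real.exp (-(1.1236 * L)) + Real.exp (-(1.35 * L)) ≤ 2 * Real.exp (-L) := by
  have a : Real.exp (-(1.1236 * L)) = Real.exp (-L) * Real.exp (-(0.1236 * L)) := by
    rw [← Real.exp_add]; congr 1; ring
  have b : Real.exp (-(1.35 * L)) = Real.exp (-L) * Real.exp (-(0.35 * L)) := by
    rw [← Real.exp_add]; congr 1; ring
  have c : Real.exp (-(0.1236 * L)) ≤ 0.7623 := by
    have h1 : Real.exp (-(0.1236 * L)) ≤ Real.exp (-0.27192) := Real.exp_le_exp.2 (by linarith)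
    refine h1.trans ((eb_exp_bd (x := 0.27192) (by norm_num)).trans ?_)
    norm_num
  have d : Real.exp (-(0.35 * L)) ≤ 0.47 := by
    have h1 : Real.exp (-(0.35 * L)) ≤ Real.exp (-0.77) := Real.exp_le_exp.2 (by linarith)
    refine h1.trans ((eb_exp_bd (x := 0.77) (by norm_num)).trans ?_)
    norm_num
  rw [a, b]
  nlinarith [Real.exp_pos (-L)]

lemma eb_e15 : Real.exp (-1.5) ≤ 1 - 0.7768 := by
  have a : Real.exp (-1.5) ^ 2 = Real.exp (-1) ^ 3 := by
    rw [← Real.exp_nat_mul, ← Real.exp_nat_mul]; congr 1; norm_num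
  have c : Real.exp (-1) ≤ 0.36788 := by
    have := Real.exp_neg_one_lt_d9; linarith
  have d : Real.exp (-1) ^ 3 ≤ 0.36788 ^ 3 := pow_le_pow_left₀ (Real.exp_pos _).le c 3
  apply le_of_sq_le_sq _ (by norm_num)
  rw [a]; refine d.trans ?_; norm_num

lemma eb_e2 : Real.exp (-2) ≤ 1 - 0.8646 := by
  have a : Real.exp (-2) = Real.exp (-1) ^ 2 := by
    rw [← Real.exp_nat_mul]; congr 1; norm_num
  have c : Real.exp (-1) ≤ 0.36788 := by
    have := Real.exp_neg_one_lt_d9; linarith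
  have d := pow_le_pow_left₀ (Real.exp_pos _).le c 2
  rw [a]; refine d.trans ?_; norm_num

lemma eb_cover {L T t W W0 nn : ℝ} (hL : 0 < L) (hnn : 0 < nn)
    (hcond : (t - 7 / 3 * L) ^ 2 + 2 * L * (t ^ 2 / nn) ≤ 2 * L * W0)
    (hT : 7 / 3 * L < T) (hD : 2 * L * (W - T ^ 2 / nn) < (T - 7 / 3 * L) ^ 2) :
    t < T ∨ W < W0 := by
  by_contra! h
  obtain ⟨h1, h2⟩ := h
  have a : (T - 7 / 3 * L) ^ 2 ≤ (t - 7 / 3 * L) ^ 2 := pow_le_pow_left₀ (by linarith) (by linarith) 2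
  have b : T ^ 2 / nn ≤ t ^ 2 / nn :=
    div_le_div_of_nonneg_right (pow_le_pow_left₀ (by linarith) h1 2) hnn.le
  have c := mul_le_mul_of_nonneg_left b (by linarith : 0 ≤ 2 * L)
  have d := mul_le_mul_of_nonneg_left h2 (by linarith : 0 ≤ 2 * L)
  linarith

lemma eb_cond {L r v M y nn : ℝ} (hL : 0 < L) (hr : 0 < r) (hv : v * r ^ 2 = 2 * L)
    (hnn : 0 < nn) (hvn : v ≤ nn * (M * (1 - M))) :
    (L * (2 * y / r + M * y ^ 2 / 3) - 7 / 3 * L) ^ 2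
      + 2 * L * ((L * (2 * y / r + M * y ^ 2 / 3)) ^ 2 / nn) ≤ 2 * L * (v * ebN r M y / 4) := by
  set τ := 2 * y / r + M * y ^ 2 / 3 with hτ
  have eN : ebN r M y = r ^ 2 * ((τ - 7 / 3) ^ 2 + M * (1 - M) * r ^ 2 * τ ^ 2) := by
    unfold ebN; rw [hτ]; field_simp; ring
  have e1 : 2 * L * (v * ebN r M y / 4) = L ^ 2 * ((τ - 7 / 3) ^ 2 + M * (1 - M) * r ^ 2 * τ ^ 2) := by
    rw [eN]
    calc _ = 2 * L * (v * r ^ 2) * ((τ - 7 / 3) ^ 2 + M * (1 - M) * r ^ 2 * τ ^ 2) / 4 := by ring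
      _ = _ := by rw [hv]; ring
  rw [e1]
  have h2 : 2 * L ≤ nn * (M * (1 - M) * r ^ 2) := by
    have := mul_le_mul_of_nonneg_right hvn (sq_nonneg r)
    rw [hv] at this; linarith
  have h3 : 2 * L * ((L * τ) ^ 2 / nn) ≤ L ^ 2 * (M * (1 - M) * r ^ 2 * τ ^ 2) := by
    rw [← mul_div_assoc, div_le_iff₀ hnn]
    have := mul_le_mul_of_nonneg_right h2 (sq_nonneg (L * τ))
    linarith
  nlinarith

/-- Deterministic part: from three tail estimates to the final bound. -/
theorem eb_abstract {Ω : Type*} [MeasurableSpace Ω] (P : Measure Ω) [IsProbabilityMeasure P]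
    (T W : Ω → ℝ) (v M L nn : ℝ) (hL : 0.6931 ≤ L) (hM0 : 1 / 2 ≤ M) (hM1 : M ≤ 1)
    (hv : 0 ≤ v) (hnn : 0 < nn) (hvn : v ≤ nn * (M * (1 - M)))
    (F1 : ∀ t, 0 < t → P.real {ω | t < T ω} ≤ v / t ^ 2)
    (F2 : ∀ l K t, 0 < l → 0 < t → (∀ x, |x| ≤ M → Real.exp (l * x) ≤ 1 + l * x + K * x ^ 2) →
      P.real {ω | t < T ω} ≤ (Real.exp (v * K) - 1) / (Real.cosh (l * t) - 1))
    (F2' : ∀ l K t, 0 < l → 0 < t → (∀ x, |x| ≤ M → Real.exp (l * x) ≤ 1 + l * x + K * x ^ 2) →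
      P.real {ω | t < T ω} ≤ 2 * Real.exp (v * K - l * t))
    (F3 : ∀ θ K W0, 0 ≤ θ → (∀ x, |x| ≤ M → Real.exp (-(θ * x ^ 2)) ≤ 1 - K * x ^ 2) →
      P.real {ω | W ω < W0} ≤ Real.exp (θ * W0 - v * K)) :
    P.real {ω | 7 / 3 * L < T ω ∧ 2 * L * (W ω - T ω ^ 2 / nn) < (T ω - 7 / 3 * L) ^ 2}
      ≤ 2 * Real.exp (-L) := by
  have hL0 : 0 < L := by linarith
  have hMp : 0 < M := by linarith
  set D := {ω | 7 / 3 * L < T ω ∧ 2 * L * (W ω - T ω ^ 2 / nn) < (T ω - 7 / 3 * L) ^ 2} with hD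
  have hDT : P.real D ≤ P.real {ω | 7 / 3 * L < T ω} := measureReal_mono (fun ω h => h.1)
  -- Regime A
  by_cases hA : v * 0.99 ^ 2 ≤ 2 * L
  · refine hDT.trans ((F2' 0.76 0.3789 (7 / 3 * L) (by norm_num) (by linarith)
      (fun x hx => eb_regA_pt (hx.trans hM1))).trans ?_)
    have : v * 0.3789 - 0.76 * (7 / 3 * L) ≤ -L := by nlinarith
    have := Real.exp_le_exp.2 this
    linarith
  push Not at hA
  have hvp : 0 < v := by nlinarith
  obtain ⟨r, hr, hvr⟩ : ∃ r, 0 < r ∧ v * r ^ 2 = 2 * L := by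
    refine ⟨√(2 * L / v), by positivity, ?_⟩
    rw [Real.sq_sqrt (by positivity)]; field_simp
  have hr99 : r < 0.99 := by
    by_contra! h
    have : (0.99 : ℝ) ^ 2 ≤ r ^ 2 := pow_le_pow_left₀ (by norm_num) h 2
    nlinarith
  have hve : v = 2 * L / r ^ 2 := by field_simp; exact hvr
  have hcov : ∀ t W0, (t - 7 / 3 * L) ^ 2 + 2 * L * (t ^ 2 / nn) ≤ 2 * L * W0 →
      P.real D ≤ P.real {ω | t < T ω} + P.real {ω | W ω < W0} := by
    intro t W0 h
    refine le_trans (measureReal_mono ?_) (measureReal_union_le _ _)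
    intro ω hω
    exact eb_cover hL0 hnn h hω.1 hω.2
  -- Bernstein parameters
  have hbern : ∀ y, 1 ≤ y → y ≤ 1.06 → ∃ l K a, 0 < l ∧ 0 < a ∧ a ≤ y ^ 2 * L ∧
      (∀ x, |x| ≤ M → Real.exp (l * x) ≤ 1 + l * x + K * x ^ 2) ∧ v * K = a ∧
      l * (L * (2 * y / r + M * y ^ 2 / 3)) = y ^ 2 * L + a := by
    intro y hy1 hy2
    have hs : 0 < 1 + M * (y * r) / 3 := by positivity
    refine ⟨y * r / (1 + M * (y * r) / 3), _, y ^ 2 * L / (1 + M * (y * r) / 3), by positivity,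
      by positivity, ?_, fun x hx => eb_bern_pt (by positivity) hMp.le ?_ hx, ?_, ?_⟩
    · apply div_le_self (by positivity)
      have : 0 ≤ M * (y * r) / 3 := by positivity
      linarith
    · rw [div_mul_eq_mul_div, div_le_one hs]
      have h1 : y * r ≤ 1.06 * 0.99 := mul_le_mul hy2 hr99.le hr.le (by norm_num)
      have h2 : M * (y * r) ≤ 1 * (1.06 * 0.99) := mul_le_mul hM1 h1 (by positivity) (by norm_num)
      linarith
    · have e : 1 - y * r / (1 + M * (y * r) / 3) * M / 3 = 1 / (1 + M * (y * r) / 3) := by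
        field_simp; ring
      rw [e, hve]
      field_simp
    · field_simp
      ring
  have htpos : ∀ y, 1 ≤ y → 0 < L * (2 * y / r + M * y ^ 2 / 3) := by
    intro y hy
    have : 0 < y := by linarith
    positivity
  by_cases hB : r ≤ 0.88
  · -- Regime B1
    have hW : ∃ W0, (L * (2 * 1 / r + M * 1 ^ 2 / 3) - 7 / 3 * L) ^ 2
      + 2 * L * ((L * (2 * 1 / r + M * 1 ^ 2 / 3)) ^ 2 / nn) ≤ 2 * L * W0 ∧
      P.real {ω | W ω < W0} ≤ Real.exp (-(2 * L)) := by
      have hc := eb_cond (y := 1) hL0 hr hvr hnn hvn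
      by_cases hr5 : r ≤ 1 / 2
      · refine ⟨v * (1 - 1.42 * M * r), hc.trans ?_, ?_⟩
        · have := ebN_small hr.le hr5 hM0 hM1
          apply mul_le_mul_of_nonneg_left _ (by linarith)
          nlinarith
        · refine (F3 (1.42 * r / M) (1.42 * r / M - (1.42 * r / M) ^ 2 * M ^ 2 / 2) _
            (by positivity) ?_).trans ?_
          · intro x hx
            have hx2 : x ^ 2 ≤ M ^ 2 := by
              rw [← sq_abs]; exact pow_le_pow_left₀ (abs_nonneg _) hx 2
            refine (eb_quad (by positivity)).trans ?_
            have h1 : (1.42 * r / M * x ^ 2) ^ 2 ≤ (1.42 * r / M) ^ 2 * (M ^ 2 * x ^ 2) := by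
              rw [mul_pow]
              apply mul_le_mul_of_nonneg_left _ (by positivity)
              nlinarith [sq_nonneg x]
            linarith
          · apply Real.exp_le_exp.2
            have e : 1.42 * r / M * (v * (1 - 1.42 * M * r)) -
              v * (1.42 * r / M - (1.42 * r / M) ^ 2 * M ^ 2 / 2) = - (1.42 ^ 2 / 2) * (v * r ^ 2) := by
              field_simp; ring
            rw [e, hvr]
            nlinarith
      · push Not at hr5
        refine ⟨_, hc, ?_⟩
        have hmid := ebN_mid (by norm_num; linarith) hB hM0 hM1
        refine (F3 (2 / M ^ 2) (0.8646 / M ^ 2) _ (by positivity) ?_).trans ?_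
        · intro x hx
          have hx2 : x ^ 2 ≤ M ^ 2 := by
            rw [← sq_abs]; exact pow_le_pow_left₀ (abs_nonneg _) hx 2
          have := eb_chord eb_e2 (z := x ^ 2 / M ^ 2) (by positivity)
            ((div_le_one (by positivity)).2 hx2)
          calc _ = Real.exp (-(2 * (x ^ 2 / M ^ 2))) := by congr 1; ring
            _ ≤ _ := this
            _ = _ := by ring
        · apply Real.exp_le_exp.2
          have e : 2 / M ^ 2 * (v * ebN r M 1 / 4) - v * (0.8646 / M ^ 2)
              = - (v * (0.8646 - ebN r M 1 / 2) / M ^ 2) := by field_simp; ring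
          rw [e, neg_le_neg_iff, le_div_iff₀ (by positivity), ← hvr]
          have := mul_le_mul_of_nonneg_left hmid hv
          linarith
    obtain ⟨W0, hc, hPW⟩ := hW
    refine (hcov _ _ hc).trans ?_
    by_cases hL14 : L ≤ 1.4
    · have h1 := F1 _ (htpos 1 le_rfl)
      have h2 : v / (L * (2 * 1 / r + M * 1 ^ 2 / 3)) ^ 2 ≤ 1 / (2 * L) := by
        rw [div_le_div_iff₀ (pow_pos (htpos 1 le_rfl) 2) (by linarith)]
        have : (L * (2 / r)) ^ 2 ≤ (L * (2 * 1 / r + M * 1 ^ 2 / 3)) ^ 2 := by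
          apply pow_le_pow_left₀ (by positivity)
          apply mul_le_mul_of_nonneg_left _ hL0.le
          have : 0 ≤ M * 1 ^ 2 / 3 := by positivity
          rw [mul_one]; linarith
        refine le_trans (le_of_eq ?_) (this.trans (by linarith))
        rw [hve]; field_simp
      have := eb_n1 hL hL14
      linarith
    · push Not at hL14
      obtain ⟨l, K, a, hl, ha, haL, hK, hvK, hlt⟩ := hbern 1 le_rfl (by norm_num)
      have h1 := F2 l K _ hl (htpos 1 le_rfl) hK
      rw [hvK, hlt] at h1
      have := eb_n2 hL14.le ha (by simpa using haL)
      simp only [one_pow, one_mul] at h1 ⊢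
      simp only [one_pow] at *
      linarith
  · push Not at hB
    by_cases hL2 : L ≤ 2.2
    · refine hDT.trans ((F1 _ (by linarith)).trans (le_trans ?_ (eb_n3 hL hL2)))
      rw [div_le_div_iff₀ (by positivity) hL0]
      have h1 : v * 0.88 ^ 2 ≤ 2 * L := by
        rw [← hvr]
        exact mul_le_mul_of_nonneg_left (pow_le_pow_left₀ (by norm_num) hB.le 2) hv
      nlinarith
    · push Not at hL2
      have hc := eb_cond (y := 1.06) hL0 hr hvr hnn hvn
      refine (hcov _ _ hc).trans (le_trans ?_ (eb_n4 hL2.le))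
      obtain ⟨l, K, a, hl, ha, haL, hK, hvK, hlt⟩ := hbern 1.06 (by norm_num) le_rfl
      have h1 := F2' l K _ hl (htpos 1.06 (by norm_num)) hK
      rw [hvK, hlt] at h1
      have e1 : a - (1.06 ^ 2 * L + a) = -(1.1236 * L) := by ring
      rw [e1] at h1
      refine add_le_add h1 ?_
      have hmid := ebN_B2 hB.le hr99.le hM0 hM1
      refine (F3 (1.5 / M ^ 2) (0.7768 / M ^ 2) _ (by positivity) ?_).trans ?_
      · intro x hx
        have hx2 : x ^ 2 ≤ M ^ 2 := by
          rw [← sq_abs]; exact pow_le_pow_left₀ (abs_nonneg _) hx 2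
        have := eb_chord eb_e15 (z := x ^ 2 / M ^ 2) (by positivity)
          ((div_le_one (by positivity)).2 hx2)
        calc _ = Real.exp (-(1.5 * (x ^ 2 / M ^ 2))) := by congr 1; ring
          _ ≤ _ := this
          _ = _ := by ring
      · apply Real.exp_le_exp.2
        have e : 1.5 / M ^ 2 * (v * ebN r M 1.06 / 4) - v * (0.7768 / M ^ 2)
            = - (v * (0.7768 - 0.375 * ebN r M 1.06) / M ^ 2) := by field_simp; ring
        rw [e, neg_le_neg_iff, le_div_iff₀ (by positivity)]
        have := mul_le_mul_of_nonneg_left hmid hv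
        have e3 : 1.35 * L = 1.35 / 2 * (v * r ^ 2) := by rw [hvr]; ring
        rw [e3]
        linarith

lemma eb_int_bdd {Ω : Type*} [MeasurableSpace Ω] (P : Measure Ω) [IsProbabilityMeasure P]
    {f : Ω → ℝ} (hf : Measurable f) (C : ℝ) (h : ∀ ω, |f ω| ≤ C) : Integrable f P :=
  Integrable.of_bound hf.aestronglyMeasurable C (Filter.Eventually.of_forall h)

/-- Moment generating function bound for the sum. -/
lemma eb_mgf {Ω : Type*} [MeasurableSpace Ω] (P : Measure Ω) [IsProbabilityMeasure P]
    {n : ℕ} (X : Fin n → Ω → ℝ) (hX : ∀ i, Measurable (X i)) (hind : iIndepFun X P)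
    (M s : ℝ) (hb : ∀ i ω, |X i ω| ≤ M) (h0 : ∀ i, ∫ ω, X i ω ∂P = 0)
    (h2 : ∀ i, ∫ ω, X i ω ^ 2 ∂P = s) (l K : ℝ)
    (hp : ∀ x : ℝ, |x| ≤ M → Real.exp (l * x) ≤ 1 + l * x + K * x ^ 2) :
    ∫ ω, Real.exp (l * ∑ i, X i ω) ∂P ≤ Real.exp ((n * s) * K) := by
  have hi : ∀ i, Integrable (X i) P := fun i => eb_int_bdd P (hX i) M (hb i)
  have hi2 : ∀ i, Integrable (fun ω => X i ω ^ 2) P := fun i =>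
    eb_int_bdd P ((hX i).pow_const 2) (M ^ 2) (fun ω => by
      rw [abs_pow]; exact pow_le_pow_left₀ (abs_nonneg _) (hb i ω) 2)
  have hie : ∀ i, Integrable (fun ω => Real.exp (l * X i ω)) P := fun i =>
    eb_int_bdd P (by have := hX i; fun_prop) (Real.exp (|l| * M)) (fun ω => by
      rw [Real.abs_exp]
      apply Real.exp_le_exp.2
      refine (le_abs_self _).trans ?_
      rw [abs_mul]
      exact mul_le_mul_of_nonneg_left (hb i ω) (abs_nonneg _))
  have e : ∫ ω, Real.exp (l * ∑ i, X i ω) ∂P = mgf (∑ i, X i) P l := by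
    simp only [mgf, Finset.sum_apply]
  rw [e, hind.mgf_sum hX]
  have hle : ∀ i, mgf (X i) P l ≤ Real.exp (s * K) := by
    intro i
    have a1 : mgf (X i) P l ≤ ∫ ω, (1 + l * X i ω + K * X i ω ^ 2) ∂P := by
      apply integral_mono (hie i)
      · exact (((integrable_const 1).add ((hi i).const_mul l)).add ((hi2 i).const_mul K))
      · intro ω; exact hp _ (hb i ω)
    have a2 : ∫ ω, (1 + l * X i ω + K * X i ω ^ 2) ∂P = 1 + s * K := by
      have q : Integrable (fun ω => 1 + l * X i ω) P :=
        (integrable_const 1).add ((hi i).const_mul l)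
      rw [integral_add q ((hi2 i).const_mul K),
        integral_add (integrable_const 1) ((hi i).const_mul l), integral_const_mul,
        integral_const_mul, h0, h2]
      simp; ring
    rw [a2] at a1
    have := Real.add_one_le_exp (s * K)
    linarith
  calc ∏ i, mgf (X i) P l ≤ ∏ _i : Fin n, Real.exp (s * K) :=
        Finset.prod_le_prod (fun i _ => mgf_nonneg) (fun i _ => hle i)
    _ = Real.exp ((n * s) * K) := by
        rw [Finset.prod_const, Finset.card_univ, Fintype.card_fin, ← Real.exp_nat_mul]
        congr 1; ring

lemma eb_mgfW {Ω : Type*} [MeasurableSpace Ω] (P : Measure Ω) [IsProbabilityMeasure P]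
    {n : ℕ} (X : Fin n → Ω → ℝ) (hX : ∀ i, Measurable (X i)) (hind : iIndepFun X P)
    (M s : ℝ) (hb : ∀ i ω, |X i ω| ≤ M)
    (h2 : ∀ i, ∫ ω, X i ω ^ 2 ∂P = s) (θ K : ℝ) (hθ : 0 ≤ θ)
    (hp : ∀ x : ℝ, |x| ≤ M → Real.exp (-(θ * x ^ 2)) ≤ 1 - K * x ^ 2) :
    ∫ ω, Real.exp ((-θ) * ∑ i, X i ω ^ 2) ∂P ≤ Real.exp (-((n * s) * K)) := by
  have hX2 : ∀ i, Measurable (fun ω => X i ω ^ 2) := fun i => (hX i).pow_const 2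
  have hi2 : ∀ i, Integrable (fun ω => X i ω ^ 2) P := fun i =>
    eb_int_bdd P (hX2 i) (M ^ 2) (fun ω => by
      rw [abs_pow]; exact pow_le_pow_left₀ (abs_nonneg _) (hb i ω) 2)
  have hie : ∀ i, Integrable (fun ω => Real.exp ((-θ) * X i ω ^ 2)) P := fun i =>
    eb_int_bdd P (by have := hX i; fun_prop) 1 (fun ω => by
      rw [Real.abs_exp]
      apply Real.exp_le_one_iff.2
      have := mul_nonneg hθ (sq_nonneg (X i ω))
      linarith)
  have hind2 : iIndepFun (fun i ω => X i ω ^ 2) P :=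
    hind.comp (fun _ x => x ^ 2) (fun _ => by fun_prop)
  have e : ∫ ω, Real.exp ((-θ) * ∑ i, X i ω ^ 2) ∂P
      = mgf (∑ i, fun ω => X i ω ^ 2) P (-θ) := by
    simp only [mgf, Finset.sum_apply]
  rw [e, hind2.mgf_sum hX2]
  have hle : ∀ i, mgf (fun ω => X i ω ^ 2) P (-θ) ≤ Real.exp (-(s * K)) := by
    intro i
    have a1 : mgf (fun ω => X i ω ^ 2) P (-θ) ≤ ∫ ω, (1 - K * X i ω ^ 2) ∂P := by
      apply integral_mono (hie i)
      · exact (integrable_const 1).sub ((hi2 i).const_mul K)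
      · intro ω
        have := hp _ (hb i ω)
        simpa only [neg_mul] using this
    have a2 : ∫ ω, (1 - K * X i ω ^ 2) ∂P = 1 - s * K := by
      rw [integral_sub (integrable_const 1) ((hi2 i).const_mul K), integral_const_mul, h2]
      simp; ring
    rw [a2] at a1
    have := Real.add_one_le_exp (-(s * K))
    linarith
  calc ∏ i, mgf (fun ω => X i ω ^ 2) P (-θ) ≤ ∏ _i : Fin n, Real.exp (-(s * K)) :=
        Finset.prod_le_prod (fun i _ => mgf_nonneg) (fun i _ => hle i)
    _ = Real.exp (-((n * s) * K)) := by
        rw [Finset.prod_const, Finset.card_univ, Fintype.card_fin, ← Real.exp_nat_mul]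
        congr 1; ring

lemma eb_sum_bd {Ω : Type*} {n : ℕ} (X : Fin n → Ω → ℝ) (M : ℝ) (hb : ∀ i ω, |X i ω| ≤ M)
    (ω : Ω) : |∑ i, X i ω| ≤ n * M := by
  refine (Finset.abs_sum_le_sum_abs _ _).trans ?_
  refine (Finset.sum_le_sum (fun i _ => hb i ω)).trans ?_
  simp

lemma eb_cosh {Ω : Type*} [MeasurableSpace Ω] (P : Measure Ω) [IsProbabilityMeasure P]
    {n : ℕ} (X : Fin n → Ω → ℝ) (hX : ∀ i, Measurable (X i)) (hind : iIndepFun X P)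
    (M s : ℝ) (hb : ∀ i ω, |X i ω| ≤ M) (h0 : ∀ i, ∫ ω, X i ω ∂P = 0)
    (h2 : ∀ i, ∫ ω, X i ω ^ 2 ∂P = s) (l K : ℝ)
    (hp : ∀ x : ℝ, |x| ≤ M → Real.exp (l * x) ≤ 1 + l * x + K * x ^ 2) :
    Integrable (fun ω => Real.cosh (l * ∑ i, X i ω)) P ∧
    ∫ ω, Real.cosh (l * ∑ i, X i ω) ∂P ≤ Real.exp ((n * s) * K) := by
  have hI : ∀ l : ℝ, Integrable (fun ω => Real.exp (l * ∑ i, X i ω)) P := fun l =>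
    eb_int_bdd P (by fun_prop) (Real.exp (|l| * (n * M))) (fun ω => by
      rw [Real.abs_exp]
      apply Real.exp_le_exp.2
      refine (le_abs_self _).trans ?_
      rw [abs_mul]
      exact mul_le_mul_of_nonneg_left (eb_sum_bd X M hb ω) (abs_nonneg _))
  have e : (fun ω => Real.cosh (l * ∑ i, X i ω)) =
      fun ω => (Real.exp (l * ∑ i, X i ω) + Real.exp ((-l) * ∑ i, X i ω)) / 2 := by
    funext ω; rw [Real.cosh_eq, neg_mul]
  have b1 := eb_mgf P X hX hind M s hb h0 h2 l K hp
  have b2 := eb_mgf P X hX hind M s hb h0 h2 (-l) K (fun x hx => by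
    have := hp (-x) (by rwa [abs_neg])
    have e1 : -l * x = l * -x := by ring
    rw [e1]
    calc _ ≤ _ := this
      _ = _ := by ring)
  rw [e]
  refine ⟨((hI l).add (hI (-l))).div_const 2, ?_⟩
  rw [integral_div, integral_add (hI l) (hI (-l))]
  linarith

lemma eb_F1 {Ω : Type*} [MeasurableSpace Ω] (P : Measure Ω) [IsProbabilityMeasure P]
    {n : ℕ} (X : Fin n → Ω → ℝ) (hX : ∀ i, Measurable (X i)) (hind : iIndepFun X P)
    (M s : ℝ) (hb : ∀ i ω, |X i ω| ≤ M) (h0 : ∀ i, ∫ ω, X i ω ∂P = 0)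
    (h2 : ∀ i, ∫ ω, X i ω ^ 2 ∂P = s) (t : ℝ) (ht : 0 < t) :
    P.real {ω | t < |∑ i, X i ω|} ≤ (n * s) / t ^ 2 := by
  have hL : ∀ i, MemLp (X i) 2 P := fun i =>
    MemLp.of_bound (hX i).aestronglyMeasurable M (Filter.Eventually.of_forall (hb i))
  have hi : ∀ i, Integrable (X i) P := fun i => eb_int_bdd P (hX i) M (hb i)
  have hv : Var[∑ i, X i; P] = n * s := by
    rw [IndepFun.variance_sum (fun i _ => hL i)
      (fun i _ j _ hij => hind.indepFun hij)]
    have : ∀ i, Var[X i; P] = s := by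
      intro i
      rw [variance_of_integral_eq_zero (hX i).aemeasurable (h0 i), h2]
    simp [this]
  have hSm : Measurable (∑ i, X i) := by fun_prop
  have hSL : MemLp (∑ i, X i) 2 P := memLp_finsetSum' _ (fun i _ => hL i)
  have hS0 : ∫ ω, (∑ i, X i) ω ∂P = 0 := by
    simp only [Finset.sum_apply]
    rw [integral_finsetSum _ (fun i _ => hi i)]
    simp [h0]
  have hE : ∫ ω, (∑ i, X i ω) ^ 2 ∂P = n * s := by
    rw [← hv, variance_of_integral_eq_zero hSm.aemeasurable hS0]
    simp only [Finset.sum_apply]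
  have hI : Integrable (fun ω => (∑ i, X i ω) ^ 2) P := by
    have := hSL.integrable_sq
    simpa only [Finset.sum_apply] using this
  have hm := mul_meas_ge_le_integral_of_nonneg
    (Filter.Eventually.of_forall (fun ω => sq_nonneg (∑ i, X i ω))) hI (t ^ 2)
  rw [hE] at hm
  rw [le_div_iff₀ (by positivity), mul_comm]
  refine le_trans (mul_le_mul_of_nonneg_left (measureReal_mono ?_) (by positivity)) hm
  intro ω hω
  simp only [Set.mem_ofPred_eq] at hω ⊢
  rw [← sq_abs (∑ i, X i ω)]
  exact pow_le_pow_left₀ ht.le hω.le 2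

lemma eb_F2 {Ω : Type*} [MeasurableSpace Ω] (P : Measure Ω) [IsProbabilityMeasure P]
    {n : ℕ} (X : Fin n → Ω → ℝ) (hX : ∀ i, Measurable (X i)) (hind : iIndepFun X P)
    (M s : ℝ) (hb : ∀ i ω, |X i ω| ≤ M) (h0 : ∀ i, ∫ ω, X i ω ∂P = 0)
    (h2 : ∀ i, ∫ ω, X i ω ^ 2 ∂P = s) (l K t : ℝ) (hl : 0 < l) (ht : 0 < t)
    (hp : ∀ x : ℝ, |x| ≤ M → Real.exp (l * x) ≤ 1 + l * x + K * x ^ 2) :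
    P.real {ω | t < |∑ i, X i ω|} ≤ (Real.exp ((n * s) * K) - 1) / (Real.cosh (l * t) - 1) ∧
    P.real {ω | t < |∑ i, X i ω|} ≤ 2 * Real.exp ((n * s) * K - l * t) := by
  obtain ⟨hI, hE⟩ := eb_cosh P X hX hind M s hb h0 h2 l K hp
  have hlt : 0 < l * t := mul_pos hl ht
  have hsub : ∀ ω, t < |∑ i, X i ω| → Real.cosh (l * t) ≤ Real.cosh (l * ∑ i, X i ω) := by
    intro ω hω
    rw [Real.cosh_le_cosh, abs_of_pos hlt, abs_mul, abs_of_pos hl]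
    exact mul_le_mul_of_nonneg_left hω.le hl.le
  constructor
  · have hc : 1 < Real.cosh (l * t) := Real.one_lt_cosh.2 hlt.ne'
    rw [le_div_iff₀ (by linarith), mul_comm]
    have hm := mul_meas_ge_le_integral_of_nonneg (μ := P)
      (f := fun ω => Real.cosh (l * ∑ i, X i ω) - 1)
      (Filter.Eventually.of_forall (fun ω => sub_nonneg.2 (Real.one_le_cosh _)))
      (hI.sub (integrable_const 1)) (Real.cosh (l * t) - 1)
    rw [integral_sub hI (integrable_const 1)] at hm
    simp only [integral_const, probReal_univ, smul_eq_mul, mul_one] at hm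
    refine le_trans (mul_le_mul_of_nonneg_left (measureReal_mono ?_) (by linarith))
      (hm.trans (by linarith))
    intro ω hω
    have := hsub ω hω
    simp only [Set.mem_ofPred_eq]
    linarith
  · have hm := mul_meas_ge_le_integral_of_nonneg (μ := P)
      (f := fun ω => Real.cosh (l * ∑ i, X i ω))
      (Filter.Eventually.of_forall (fun ω => (Real.cosh_pos _).le))
      hI (Real.cosh (l * t))
    have hm2 : Real.cosh (l * t) * P.real {ω | t < |∑ i, X i ω|} ≤ Real.exp ((n * s) * K) := by
      refine le_trans (mul_le_mul_of_nonneg_left (measureReal_mono ?_) (Real.cosh_pos _).le)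
        (hm.trans hE)
      intro ω hω
      exact hsub ω hω
    have hc : Real.exp (l * t) / 2 ≤ Real.cosh (l * t) := by
      rw [Real.cosh_eq]; have := Real.exp_pos (-(l * t)); linarith
    have h3 := (mul_le_mul_of_nonneg_right hc
      (measureReal_nonneg (μ := P) (s := {ω | t < |∑ i, X i ω|}))).trans hm2
    rw [Real.exp_sub, ← mul_div_assoc, le_div_iff₀ (Real.exp_pos _)]
    linarith

lemma eb_F3 {Ω : Type*} [MeasurableSpace Ω] (P : Measure Ω) [IsProbabilityMeasure P]
    {n : ℕ} (X : Fin n → Ω → ℝ) (hX : ∀ i, Measurable (X i)) (hind : iIndepFun X P)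
    (M s : ℝ) (hb : ∀ i ω, |X i ω| ≤ M)
    (h2 : ∀ i, ∫ ω, X i ω ^ 2 ∂P = s) (θ K W0 : ℝ) (hθ : 0 ≤ θ)
    (hp : ∀ x : ℝ, |x| ≤ M → Real.exp (-(θ * x ^ 2)) ≤ 1 - K * x ^ 2) :
    P.real {ω | ∑ i, X i ω ^ 2 < W0} ≤ Real.exp (θ * W0 - (n * s) * K) := by
  have hE := eb_mgfW P X hX hind M s hb h2 θ K hθ hp
  have hI : Integrable (fun ω => Real.exp ((-θ) * ∑ i, X i ω ^ 2)) P :=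
    eb_int_bdd P (by fun_prop) 1 (fun ω => by
      rw [Real.abs_exp]
      apply Real.exp_le_one_iff.2
      have := mul_nonneg hθ (Finset.sum_nonneg (fun i (_ : i ∈ Finset.univ) => sq_nonneg (X i ω)))
      linarith)
  have hm := mul_meas_ge_le_integral_of_nonneg (μ := P)
      (f := fun ω => Real.exp ((-θ) * ∑ i, X i ω ^ 2))
      (Filter.Eventually.of_forall (fun ω => (Real.exp_pos _).le))
      hI (Real.exp (-(θ * W0)))
  have hm2 : Real.exp (-(θ * W0)) * P.real {ω | ∑ i, X i ω ^ 2 < W0}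
      ≤ Real.exp (-((n * s) * K)) := by
    refine le_trans (mul_le_mul_of_nonneg_left (measureReal_mono ?_) (Real.exp_pos _).le)
      (hm.trans hE)
    intro ω hω
    simp only [Set.mem_ofPred_eq] at hω ⊢
    apply Real.exp_le_exp.2
    have := mul_le_mul_of_nonneg_left hω.le hθ
    linarith
  have e : Real.exp (θ * W0 - (n * s) * K) = Real.exp (-((n * s) * K)) / Real.exp (-(θ * W0)) := by
    rw [← Real.exp_sub]; congr 1; ring
  rw [e, le_div_iff₀ (Real.exp_pos _), mul_comm]
  exact hm2

lemma eb_event {n : ℕ} (hn : 2 ≤ n) (z : Fin n → ℝ) (m L : ℝ) (hL : 0 < L)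
    (h : Real.sqrt (2 * ((1 / n) * ∑ i, (z i - (1 / n) * ∑ j, z j) ^ 2) *
          L / (n - 1)) + 7 * L / (3 * (n - 1)) < |m - (1 / n) * ∑ i, z i|) :
    7 / 3 * L < |∑ i, (z i - m)| ∧
    2 * L * (∑ i, (z i - m) ^ 2 - |∑ i, (z i - m)| ^ 2 / n) < (|∑ i, (z i - m)| - 7 / 3 * L) ^ 2 := by
  have hn' : (2 : ℝ) ≤ n := by exact_mod_cast hn
  have hnp : (0 : ℝ) < n := by linarith
  have hn1 : (0 : ℝ) < n - 1 := by linarith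
  have hS : ∑ i, (z i - m) = ∑ i, z i - n * m := by simp
  have hA : ∑ i, (z i - m) ^ 2 = ∑ i, z i ^ 2 - 2 * m * ∑ i, z i + n * m ^ 2 := by
    rw [Finset.mul_sum, ← Finset.sum_sub_distrib]
    have : (n : ℝ) * m ^ 2 = ∑ _i : Fin n, m ^ 2 := by simp
    rw [this, ← Finset.sum_add_distrib]
    exact Finset.sum_congr rfl (fun i _ => by ring)
  have hB : ∑ i, (z i - (1 / n) * ∑ j, z j) ^ 2
      = ∑ i, (z i - m) ^ 2 - |∑ i, (z i - m)| ^ 2 / n := by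
    rw [sq_abs, hA, hS]
    generalize hc : ∑ j, z j = c
    have : ∀ a : ℝ, ∑ i, (z i - a) ^ 2 = ∑ i, z i ^ 2 - 2 * a * ∑ i, z i + n * a ^ 2 := by
      intro a
      rw [Finset.mul_sum, ← Finset.sum_sub_distrib]
      have : (n : ℝ) * a ^ 2 = ∑ _i : Fin n, a ^ 2 := by simp
      rw [this, ← Finset.sum_add_distrib]
      exact Finset.sum_congr rfl (fun i _ => by ring)
    rw [this, hc]
    field_simp
    ring
  have hT : |m - (1 / n) * ∑ i, z i| = |∑ i, (z i - m)| / n := by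
    rw [hS, abs_sub_comm, ← abs_of_pos hnp, ← abs_div, abs_of_pos hnp]
    congr 1
    field_simp
  have hQ0 : 0 ≤ ∑ i, (z i - (1 / n) * ∑ j, z j) ^ 2 :=
    Finset.sum_nonneg (fun i _ => sq_nonneg _)
  rw [hT] at h
  rw [← hB]
  generalize ∑ i, (z i - (1 / n) * ∑ j, z j) ^ 2 = Q at *
  generalize |∑ i, (z i - m)| = T at *
  clear hS hA hB hT
  rw [lt_div_iff₀ hnp] at h
  set R := Real.sqrt (2 * (1 / n * Q) * L / (n - 1)) with hR
  have hR0 : 0 ≤ R := Real.sqrt_nonneg _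
  have hRs : R ^ 2 = 2 * (1 / n * Q) * L / (n - 1) := Real.sq_sqrt (by positivity)
  have h7 : 7 / 3 * L ≤ 7 * L / (3 * (n - 1)) * n := by
    rw [div_mul_eq_mul_div (7 * L), le_div_iff₀ (by positivity)]
    nlinarith
  have hRn : R * n < T - 7 / 3 * L := by linarith
  have hRn0 : 0 ≤ R * n := by positivity
  refine ⟨by linarith, ?_⟩
  have h8 : 2 * L * Q ≤ (R * n) ^ 2 := by
    rw [mul_pow, hRs]
    have : 2 * (1 / n * Q) * L / (n - 1) * (n : ℝ) ^ 2 = (2 * L * Q) * (n / (n - 1)) := by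
      field_simp
    rw [this]
    apply le_mul_of_one_le_right (by positivity)
    rw [le_div_iff₀ hn1]; linarith
  exact h8.trans_lt (pow_lt_pow_left₀ hRn hRn0 two_ne_zero)

/-- Empirical Bernstein inequality (Maurer–Pontil): for i.i.d. `[0,1]`-valued random
variables `Z₁,…,Zₙ` with `n ≥ 2`, the empirical mean deviates from the true mean by
more than `√(2·V̂ₙ·ln(2/δ)/(n−1)) + 7·ln(2/δ)/(3(n−1))` with probability at most `δ`,
where `V̂ₙ` is the empirical variance. -/
theorem empirical_bernstein
    {Ω : Type*} [MeasureSpace Ω] [IsProbabilityMeasure (ℙ : Measure Ω)]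
    (n : ℕ) (hn : 2 ≤ n) (Z : Fin n → Ω → ℝ)
    (hmeas : ∀ i, Measurable (Z i))
    (hindep : iIndepFun Z ℙ)
    (hident : ∀ i, IdentDistrib (Z i) (Z ⟨0, by omega⟩) ℙ ℙ)
    (hbd : ∀ i ω, Z i ω ∈ Set.Icc (0 : ℝ) 1)
    (δ : ℝ) (hδ : 0 < δ) :
    (ℙ {ω | Real.sqrt (2 * ((1 / n) * ∑ i, (Z i ω - (1 / n) * ∑ j, Z j ω) ^ 2) *
          Real.log (2 / δ) / (n - 1)) + 7 * Real.log (2 / δ) / (3 * (n - 1)) <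
        |(∫ ω', Z ⟨0, by omega⟩ ω') - (1 / n) * ∑ i, Z i ω|}).toReal ≤ δ := by
  change (ℙ : Measure Ω).real _ ≤ δ
  rcases le_or_gt 1 δ with h1 | h1
  · exact measureReal_le_one.trans h1
  set i0 : Fin n := ⟨0, by omega⟩ with hi0
  set m : ℝ := ∫ ω', Z i0 ω' with hm
  set L := Real.log (2 / δ) with hLd
  have hL2 : Real.log 2 ≤ L := Real.log_le_log (by norm_num) (by
    rw [le_div_iff₀ hδ]; linarith)
  have hL : 0.6931 ≤ L := by have := Real.log_two_gt_d9; linarith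
  have hL0 : 0 < L := by linarith
  have hδL : 2 * Real.exp (-L) = δ := by
    rw [Real.exp_neg, hLd, Real.exp_log (by positivity)]; field_simp
  have hnp : (0 : ℝ) < n := by
    have : (2 : ℝ) ≤ n := by exact_mod_cast hn
    linarith
  have hZi : ∀ i, Integrable (Z i) ℙ := fun i =>
    eb_int_bdd ℙ (hmeas i) 1 (fun ω => abs_le.2 ⟨by linarith [(hbd i ω).1], (hbd i ω).2⟩)
  have hm0 : 0 ≤ m := integral_nonneg (fun ω => (hbd i0 ω).1)
  have hm1 : m ≤ 1 := by
    have := integral_mono (hZi i0) (integrable_const (1 : ℝ)) (fun ω => (hbd i0 ω).2)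
    simpa using this
  have hXm : ∀ i, Measurable (fun ω => Z i ω - m) := fun i => (hmeas i).sub_const m
  have hXind : iIndepFun (fun i ω => Z i ω - m) ℙ :=
    hindep.comp (fun _ x => x - m) (fun _ => by fun_prop)
  set M := max m (1 - m) with hM
  have hXb : ∀ i ω, |Z i ω - m| ≤ M := by
    intro i ω
    have := hbd i ω
    rw [abs_le]
    constructor
    · linarith [le_max_left m (1 - m), this.1]
    · linarith [le_max_right m (1 - m), this.2]
  have hX0 : ∀ i, ∫ ω, (Z i ω - m) = 0 := by
    intro i
    rw [integral_sub (hZi i) (integrable_const m), (hident i).integral_eq]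
    simp [hm]
  set s : ℝ := ∫ ω, (Z i0 ω - m) ^ 2 with hs
  have hX2 : ∀ i, ∫ ω, (Z i ω - m) ^ 2 = s := by
    intro i
    exact ((hident i).comp (u := fun x => (x - m) ^ 2) (by fun_prop)).integral_eq
  have hs0 : 0 ≤ s := integral_nonneg (fun ω => sq_nonneg _)
  have hsM : s ≤ M * (1 - M) := by
    have e1 : M * (1 - M) = m * (1 - m) := by
      rcases max_choice m (1 - m) with h | h <;> rw [hM, h] <;> ring
    have a1 : s ≤ ∫ ω, ((1 - 2 * m) * Z i0 ω + m ^ 2) := by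
      apply integral_mono
      · exact eb_int_bdd ℙ ((hXm i0).pow_const 2) (M ^ 2) (fun ω => by
          rw [abs_pow]; exact pow_le_pow_left₀ (abs_nonneg _) (hXb i0 ω) 2)
      · exact ((hZi i0).const_mul _).add (integrable_const _)
      · intro ω
        have h1 := (hbd i0 ω).1
        have h2 := (hbd i0 ω).2
        show (Z i0 ω - m) ^ 2 ≤ (1 - 2 * m) * Z i0 ω + m ^ 2
        nlinarith [mul_nonneg h1 (sub_nonneg.2 h2)]
    rw [integral_add ((hZi i0).const_mul _) (integrable_const _), integral_const_mul, ← hm] at a1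
    simp only [integral_const, probReal_univ, smul_eq_mul, one_mul] at a1
    rw [e1]
    linarith
  have hM0 : 1 / 2 ≤ M := by
    linarith [le_max_left m (1 - m), le_max_right m (1 - m)]
  have hM1 : M ≤ 1 := max_le hm1 (by linarith)
  rw [← hδL]
  refine le_trans (measureReal_mono ?_) (eb_abstract ℙ (fun ω => |∑ i, (Z i ω - m)|)
    (fun ω => ∑ i, (Z i ω - m) ^ 2) (n * s) M L n hL hM0 hM1 (by positivity) hnp
    (mul_le_mul_of_nonneg_left hsM hnp.le)
    (fun t ht => eb_F1 ℙ _ hXm hXind M s hXb hX0 hX2 t ht)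
    (fun l K t hl ht hp => (eb_F2 ℙ _ hXm hXind M s hXb hX0 hX2 l K t hl ht hp).1)
    (fun l K t hl ht hp => (eb_F2 ℙ _ hXm hXind M s hXb hX0 hX2 l K t hl ht hp).2)
    (fun θ K W0 hθ hp => eb_F3 ℙ _ hXm hXind M s hXb hX2 θ K W0 hθ hp))
  intro ω hω
  exact eb_event hn (fun i => Z i ω) m L hL0 hω
end

section
/- Let (Mₙ)_{n≥0} be a martingale with respect to a filtration (ℱₙ) on a probability space, with M₀ = 0 and |Mₙ − Mₙ₋₁| ≤ c almost surely for every n ≥ 1, where c > 0 is a constant. For n ≥ 0 let Varₙ = Σ_{k=1}^{n} 𝔼[ (M_k − M_{k−1})² | ℱ_{k−1} ]. Then for every positive integer n and all real ε, δ > 0 with ε ≤ n·c²: ℙ( |Mₙ| ≥ 2√2·√(Varₙ·ln(1/δ)) + 2·√(ε·ln(1/δ)) + 2c·ln(1/δ) ) ≤ 2·( log₂(n·c²/ε) + 1 )·δ. -/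
open MeasureTheory ProbabilityTheory

lemma snm_exp_bound (x y : ℝ) (hxy : |x| ≤ y) (hy : y < 1) :
    Real.exp x ≤ 1 + x + x ^ 2 / (2 * (1 - y)) := by
  have h := Real.exp_bound (x := x) (by linarith) (n := 3) (by norm_num)
  have h2 := (abs_le.1 h).2
  simp [Finset.sum_range_succ, Nat.factorial] at h2
  have h3 : |x| ^ 3 = x ^ 2 * |x| := by rw [pow_succ, sq_abs]
  rw [h3] at h2
  have h4 : x ^ 2 / 2 + x ^ 2 * |x| * (2 / 9) ≤ x ^ 2 / (2 * (1 - y)) := by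
    rw [le_div_iff₀ (by linarith)]
    have h0 := abs_nonneg x
    have : (1 + 4 / 9 * |x|) * (1 - y) ≤ 1 := by nlinarith
    nlinarith [mul_le_mul_of_nonneg_left this (sq_nonneg x)]
  norm_num at h2
  linarith

lemma snm_mgf
    {Ω : Type*} {m0 : MeasurableSpace Ω} {μ : Measure Ω} [IsProbabilityMeasure μ]
    (ℱ : Filtration ℕ m0) (M : ℕ → Ω → ℝ) (hM : Martingale M ℱ μ)
    (hM0 : ∀ ω, M 0 ω = 0) (c : ℝ) (hc : 0 < c)
    (hbdd : ∀ n : ℕ, ∀ᵐ ω ∂μ, |M (n + 1) ω - M n ω| ≤ c)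
    (l K y : ℝ) (hl : |l| * c ≤ y) (hy : y < 1) (hK : K = l ^ 2 / (2 * (1 - y)))
    (V : ℕ → Ω → ℝ) (hV0 : ∀ ω, V 0 ω = 0)
    (hV : ∀ n ω, V (n + 1) ω = V n ω +
      (μ[fun ω' => (M (n + 1) ω' - M n ω') ^ 2 | ℱ n]) ω) (n : ℕ) :
    StronglyMeasurable[ℱ n] (V n) ∧ (∀ᵐ ω ∂μ, 0 ≤ V n ω) ∧ (∀ᵐ ω ∂μ, V n ω ≤ n * c ^ 2) ∧
    (∀ᵐ ω ∂μ, |M n ω| ≤ n * c) ∧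
    Integrable (fun ω => Real.exp (l * M n ω - K * V n ω)) μ ∧
    ∫ ω, Real.exp (l * M n ω - K * V n ω) ∂μ ≤ 1 := by
  have hK0 : 0 ≤ K := by
    rw [hK]; exact div_nonneg (sq_nonneg _) (by linarith)
  induction n with
  | zero =>
    have h0 : V 0 = fun _ => 0 := funext hV0
    refine ⟨by rw [h0]; exact stronglyMeasurable_const, ?_, ?_, ?_, ?_, ?_⟩ <;>
      simp [hM0, hV0]
  | succ n ih =>
    obtain ⟨iV, iV0, iV1, iM, iI, iE⟩ := ih
    set X : Ω → ℝ := fun ω => M (n + 1) ω - M n ω with hX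
    set v : Ω → ℝ := μ[fun ω' => (M (n + 1) ω' - M n ω') ^ 2 | ℱ n] with hv
    have hvm : StronglyMeasurable[ℱ n] v := stronglyMeasurable_condExp
    have hle : ℱ n ≤ m0 := ℱ.le n
    have hXm : StronglyMeasurable X :=
      ((hM.stronglyMeasurable (n+1)).mono (ℱ.le _)).sub ((hM.stronglyMeasurable n).mono hle)
    have hXi : Integrable X μ := (hM.integrable _).sub (hM.integrable _)
    have hX2i : Integrable (fun ω => X ω ^ 2) μ := by
      refine Integrable.of_bound (C := c ^ 2) (hXm.pow 2).aestronglyMeasurable ?_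
      filter_upwards [hbdd n] with ω h
      rw [Real.norm_eq_abs, abs_pow]
      exact pow_le_pow_left₀ (abs_nonneg _) h 2
    have hv0 : ∀ᵐ ω ∂μ, 0 ≤ v ω := by
      have := condExp_nonneg (m := ℱ n) (μ := μ) (f := fun ω => X ω ^ 2)
        (Filter.Eventually.of_forall fun ω => sq_nonneg _)
      exact this
    have hv1 : ∀ᵐ ω ∂μ, v ω ≤ c ^ 2 := by
      have := condExp_mono (m := ℱ n) (μ := μ) (f := fun ω => X ω ^ 2) (g := fun _ => c ^ 2)
        hX2i (integrable_const _) (by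
          filter_upwards [hbdd n] with ω h
          rw [← sq_abs]
          exact pow_le_pow_left₀ (abs_nonneg _) h 2)
      rw [condExp_const hle] at this
      exact this
    have hXc : μ[X | ℱ n] =ᵐ[μ] 0 := by
      have h1 := condExp_sub (hM.integrable (n+1)) (hM.integrable n) (ℱ n)
      have h2 := hM.condExp_ae_eq (Nat.le_succ n)
      have h3 := hM.condExp_ae_eq (le_refl n)
      filter_upwards [h1, h2, h3] with ω a b d
      have : (μ[X | ℱ n]) ω = (μ[M (n+1) - M n | ℱ n]) ω := rfl
      rw [this, a, Pi.sub_apply, d]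
      simp [b]
    have hVs : V (n+1) = V n + v := funext fun ω => hV n ω
    set Z : Ω → ℝ := fun ω => Real.exp (l * M n ω - K * V n ω - K * v ω) with hZ
    have hZm : StronglyMeasurable[ℱ n] Z := by
      apply Real.continuous_exp.comp_stronglyMeasurable
      exact (((hM.stronglyMeasurable n).const_mul l).sub (iV.const_mul K)).sub (hvm.const_mul K)
    have hZb : ∀ᵐ ω ∂μ, ‖Z ω‖ ≤ Real.exp (|l| * (n * c)) := by
      filter_upwards [iV0, hv0, iM] with ω a b d
      rw [Real.norm_eq_abs, abs_of_pos (Real.exp_pos _)]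
      apply Real.exp_le_exp.2
      have h1 : l * M n ω ≤ |l| * (n * c) :=
        (le_abs_self _).trans (by rw [abs_mul]; exact mul_le_mul_of_nonneg_left d (abs_nonneg _))
      nlinarith [mul_nonneg hK0 a, mul_nonneg hK0 b]
    have hZm0 : AEStronglyMeasurable Z μ := (hZm.mono hle).aestronglyMeasurable
    have hZi : Integrable Z μ := Integrable.of_bound hZm0 _ hZb
    have hZXi : Integrable (fun ω => Z ω * X ω) μ := hXi.bdd_mul hZm0 hZb
    have hZX2i : Integrable (fun ω => Z ω * X ω ^ 2) μ := hX2i.bdd_mul hZm0 hZb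
    have hvi : Integrable v μ := integrable_condExp
    have hZvi : Integrable (fun ω => Z ω * v ω) μ := hvi.bdd_mul hZm0 hZb
    have eX : ∫ ω, Z ω * X ω ∂μ = 0 := by
      have h := condExp_mul_of_stronglyMeasurable_left (μ := μ) hZm hZXi hXi
      have h2 := integral_condExp (μ := μ) (f := Z * X) hle
      rw [integral_congr_ae h] at h2
      have h3 : ∫ ω, (Z * μ[X | ℱ n]) ω ∂μ = 0 := by
        rw [integral_congr_ae (g := fun _ => (0:ℝ))]
        · simp
        · filter_upwards [hXc] with ω a
          simp [a]
      rw [h3] at h2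
      exact h2.symm
    have eX2 : ∫ ω, Z ω * X ω ^ 2 ∂μ = ∫ ω, Z ω * v ω ∂μ := by
      have h := condExp_mul_of_stronglyMeasurable_left (μ := μ) (g := fun ω => X ω ^ 2) hZm hZX2i hX2i
      have h2 := integral_condExp (μ := μ) (f := Z * fun ω => X ω ^ 2) hle
      rw [integral_congr_ae h] at h2
      exact h2.symm
    have iV0' : ∀ᵐ ω ∂μ, 0 ≤ V (n+1) ω := by
      filter_upwards [iV0, hv0] with ω a b
      rw [hVs]; exact add_nonneg a b
    have iM' : ∀ᵐ ω ∂μ, |M (n+1) ω| ≤ (n+1 : ℕ) * c := by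
      filter_upwards [iM, hbdd n] with ω a b
      have := abs_add_le (M n ω) (M (n+1) ω - M n ω)
      rw [add_sub_cancel] at this
      push_cast; linarith
    have hVm' : StronglyMeasurable[ℱ (n+1)] (V (n+1)) := by
      rw [hVs]; exact (iV.add hvm).mono (ℱ.mono (Nat.le_succ n))
    have iI' : Integrable (fun ω => Real.exp (l * M (n+1) ω - K * V (n+1) ω)) μ := by
      refine Integrable.of_bound (C := Real.exp (|l| * ((n+1 : ℕ) * c))) ?_ ?_
      · apply StronglyMeasurable.aestronglyMeasurable
        apply Real.continuous_exp.comp_stronglyMeasurable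
        exact ((((hM.stronglyMeasurable (n+1))).const_mul l).sub (hVm'.const_mul K)).mono (ℱ.le _)
      · filter_upwards [iV0', iM'] with ω a d
        rw [Real.norm_eq_abs, abs_of_pos (Real.exp_pos _)]
        apply Real.exp_le_exp.2
        have h1 : l * M (n+1) ω ≤ |l| * ((n+1 : ℕ) * c) :=
          (le_abs_self _).trans (by rw [abs_mul]; exact mul_le_mul_of_nonneg_left d (abs_nonneg _))
        nlinarith [mul_nonneg hK0 a]
    refine ⟨hVm', iV0', ?_, iM', iI', ?_⟩
    · filter_upwards [iV1, hv1] with ω a b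
      rw [hVs, Pi.add_apply]; push_cast; linarith
    · calc ∫ ω, Real.exp (l * M (n+1) ω - K * V (n+1) ω) ∂μ
          ≤ ∫ ω, (Z ω + l * (Z ω * X ω) + K * (Z ω * X ω ^ 2)) ∂μ := by
            refine integral_mono_ae iI' ((hZi.add (hZXi.const_mul l)).add (hZX2i.const_mul K)) ?_
            filter_upwards [hbdd n] with ω a
            have h1 : Real.exp (l * M (n+1) ω - K * V (n+1) ω) = Z ω * Real.exp (l * X ω) := by
              rw [hZ, ← Real.exp_add, hVs, Pi.add_apply]
              congr 1
              simp only [hX]; ring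
            have h2 := snm_exp_bound (l * X ω) y (by
              rw [abs_mul]
              exact (mul_le_mul_of_nonneg_left a (abs_nonneg _)).trans hl) hy
            have h3 : (l * X ω) ^ 2 / (2 * (1 - y)) = K * X ω ^ 2 := by rw [hK]; ring
            rw [h3] at h2
            have h4 := mul_le_mul_of_nonneg_left h2 (Real.exp_pos (l * M n ω - K * V n ω - K * v ω)).le
            change _ ≤ Z ω + l * (Z ω * X ω) + K * (Z ω * X ω ^ 2)
            rw [h1]
            refine h4.trans (le_of_eq ?_)
            simp only [hZ]; ring
        _ = ∫ ω, (Z ω + K * (Z ω * v ω)) ∂μ := by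
            have hs : Integrable (fun ω => Z ω + l * (Z ω * X ω)) μ := hZi.add (hZXi.const_mul l)
            rw [integral_add hs (hZX2i.const_mul K),
              integral_add hZi (hZXi.const_mul l), integral_add hZi (hZvi.const_mul K),
              integral_const_mul, integral_const_mul, integral_const_mul, eX, eX2]
            ring
        _ ≤ ∫ ω, Real.exp (l * M n ω - K * V n ω) ∂μ := by
            refine integral_mono (hZi.add (hZvi.const_mul K)) iI fun ω => ?_
            have h1 : Real.exp (l * M n ω - K * V n ω) = Z ω * Real.exp (K * v ω) := by
              rw [hZ, ← Real.exp_add]; congr 1; ring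
            have h2 := mul_le_mul_of_nonneg_left (Real.add_one_le_exp (K * v ω))
              (Real.exp_pos (l * M n ω - K * V n ω - K * v ω)).le
            change Z ω + K * (Z ω * v ω) ≤ _
            rw [h1]
            refine le_trans (le_of_eq ?_) h2
            simp only [hZ]; ring
        _ ≤ 1 := iE

lemma snm_tail
    {Ω : Type*} {m0 : MeasurableSpace Ω} {μ : Measure Ω} [IsProbabilityMeasure μ]
    (ℱ : Filtration ℕ m0) (M : ℕ → Ω → ℝ) (hM : Martingale M ℱ μ)
    (hM0 : ∀ ω, M 0 ω = 0) (c : ℝ) (hc : 0 < c)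
    (hbdd : ∀ n : ℕ, ∀ᵐ ω ∂μ, |M (n + 1) ω - M n ω| ≤ c)
    (V : ℕ → Ω → ℝ) (hV0 : ∀ ω, V 0 ω = 0)
    (hV : ∀ n ω, V (n + 1) ω = V n ω +
      (μ[fun ω' => (M (n + 1) ω' - M n ω') ^ 2 | ℱ n]) ω) (n : ℕ)
    (b L : ℝ) (hb : 0 < b) (hL : 0 < L) :
    μ.real {ω | V n ω ≤ b ∧ Real.sqrt (2 * b * L) + c * L ≤ |M n ω|} ≤ 2 * Real.exp (-L) := by
  set w := Real.sqrt (2 * L) with hw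
  set s := Real.sqrt b with hs
  have hw0 : 0 < w := Real.sqrt_pos.2 (by linarith)
  have hs0 : 0 < s := Real.sqrt_pos.2 hb
  have hw2 : w ^ 2 = 2 * L := Real.sq_sqrt (by linarith)
  have hs2 : s ^ 2 = b := Real.sq_sqrt hb.le
  have hsw : Real.sqrt (2 * b * L) = s * w := by
    rw [hs, hw, ← Real.sqrt_mul hb.le]; congr 1; ring
  have hd : 0 < s + c * w := by positivity
  set l := w / (s + c * w) with hl
  have hl0 : 0 < l := by positivity
  have hlc : 1 - l * c = s / (s + c * w) := by rw [hl]; field_simp; ring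
  have hy : l * c < 1 := by
    have : 0 < s / (s + c * w) := by positivity
    linarith
  set K := l ^ 2 / (2 * (1 - l * c)) with hK
  have hK0 : 0 ≤ K := div_nonneg (sq_nonneg _) (by linarith)
  have key : l * (s * w + c * L) - K * b = L := by
    have hL2 : L = w ^ 2 / 2 := by linarith
    rw [hK, hlc, hl, ← hs2, hL2]
    field_simp
    ring
  have one : ∀ t : ℝ, |t| = l → μ.real {ω | Real.exp L ≤ Real.exp (t * M n ω - K * V n ω)}
      ≤ Real.exp (-L) := by
    intro t ht
    obtain ⟨-, -, -, -, hI, hE⟩ := snm_mgf ℱ M hM hM0 c hc hbdd t K (l * c) (by rw [ht]) hy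
      (by rw [hK, ← sq_abs t, ht]) V hV0 hV n
    have := mul_meas_ge_le_integral_of_nonneg
      (Filter.Eventually.of_forall fun ω => (Real.exp_pos (t * M n ω - K * V n ω)).le) hI
      (Real.exp L)
    rw [Real.exp_neg, ← one_div, le_div_iff₀ (Real.exp_pos _), mul_comm]
    exact this.trans hE
  have hsub : {ω | V n ω ≤ b ∧ Real.sqrt (2 * b * L) + c * L ≤ |M n ω|} ⊆
      {ω | Real.exp L ≤ Real.exp (l * M n ω - K * V n ω)} ∪
      {ω | Real.exp L ≤ Real.exp ((-l) * M n ω - K * V n ω)} := by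
    rintro ω ⟨h1, h2⟩
    rw [hsw] at h2
    have h3 := mul_le_mul_of_nonneg_left h1 hK0
    rcases le_abs.1 h2 with h | h
    · left
      apply Real.exp_le_exp.2
      have := mul_le_mul_of_nonneg_left h hl0.le
      linarith
    · right
      apply Real.exp_le_exp.2
      have := mul_le_mul_of_nonneg_left h hl0.le
      linarith
  calc _ ≤ _ := measureReal_mono hsub
    _ ≤ _ := measureReal_union_le _ _
    _ ≤ Real.exp (-L) + Real.exp (-L) :=
      add_le_add (one l (abs_of_pos hl0)) (one (-l) (by rw [abs_neg, abs_of_pos hl0]))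
    _ = _ := by ring

/-- Self-normalized martingale concentration (Lemma 10 of Zhang et al.): for a
martingale `M` with `M₀ = 0` and increments bounded by `c`, with predictable quadratic
variation `Varₙ`, for every `n ≥ 1` and `ε, δ > 0` with `ε ≤ n·c²`, the deviation
`|Mₙ| ≥ 2√2·√(Varₙ·ln(1/δ)) + 2√(ε·ln(1/δ)) + 2c·ln(1/δ)` has probability at most
`2(log₂(n·c²/ε) + 1)·δ`. -/
theorem self_normalized_martingale
    {Ω : Type*} {m0 : MeasurableSpace Ω} {μ : Measure Ω} [IsProbabilityMeasure μ]
    (ℱ : Filtration ℕ m0) (M : ℕ → Ω → ℝ) (hM : Martingale M ℱ μ)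
    (hM0 : ∀ ω, M 0 ω = 0) (c : ℝ) (hc : 0 < c)
    (hbdd : ∀ n : ℕ, 1 ≤ n → ∀ᵐ ω ∂μ, |M n ω - M (n - 1) ω| ≤ c)
    (Var : ℕ → Ω → ℝ)
    (hVar : ∀ n ω, Var n ω =
      ∑ k ∈ Finset.Icc 1 n, (μ[fun ω' => (M k ω' - M (k - 1) ω') ^ 2 | ℱ (k - 1)]) ω)
    (n : ℕ) (hn : 1 ≤ n) (ε δ : ℝ) (hε : 0 < ε) (hδ : 0 < δ) (hεn : ε ≤ n * c ^ 2) :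
    (μ {ω | 2 * Real.sqrt 2 * Real.sqrt (Var n ω * Real.log (1 / δ)) +
        2 * Real.sqrt (ε * Real.log (1 / δ)) + 2 * c * Real.log (1 / δ) ≤ |M n ω|}).toReal
      ≤ 2 * (Real.logb 2 (n * c ^ 2 / ε) + 1) * δ := by
  have hbdd' : ∀ n : ℕ, ∀ᵐ ω ∂μ, |M (n + 1) ω - M n ω| ≤ c := fun n => by
    simpa using hbdd (n + 1) (by omega)
  have hV0 : ∀ ω, Var 0 ω = 0 := fun ω => by simp [hVar]
  have hV : ∀ n ω, Var (n + 1) ω = Var n ω +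
      (μ[fun ω' => (M (n + 1) ω' - M n ω') ^ 2 | ℱ n]) ω := fun n ω => by
    rw [hVar, hVar, Finset.sum_Icc_succ_top (by omega)]
    rfl
  have hR : 1 ≤ n * c ^ 2 / ε := by rwa [le_div_iff₀ hε, one_mul]
  have hlog : 0 ≤ Real.logb 2 (n * c ^ 2 / ε) := Real.logb_nonneg (by norm_num) hR
  rcases le_or_gt 1 δ with h1 | h1
  · have : (μ {ω | 2 * Real.sqrt 2 * Real.sqrt (Var n ω * Real.log (1 / δ)) +
        2 * Real.sqrt (ε * Real.log (1 / δ)) + 2 * c * Real.log (1 / δ) ≤ |M n ω|}).toReal ≤ 1 :=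
      measureReal_le_one
    nlinarith
  set L := Real.log (1 / δ) with hLdef
  have hL : 0 < L := Real.log_pos (by rw [lt_div_iff₀ hδ]; linarith)
  have hexp : Real.exp (-L) = δ := by
    rw [hLdef, one_div, Real.log_inv, neg_neg, Real.exp_log hδ]
  set N := ⌊Real.logb 2 (n * c ^ 2 / ε)⌋₊ + 1 with hN
  have hN1 : (N : ℝ) ≤ Real.logb 2 (n * c ^ 2 / ε) + 1 := by
    rw [hN]; push_cast
    linarith [Nat.floor_le hlog]
  have hN2 : n * c ^ 2 < 2 ^ N * ε := by
    have h := Nat.lt_floor_add_one (Real.logb 2 (n * c ^ 2 / ε))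
    have h' : Real.logb 2 (n * c ^ 2 / ε) < (N : ℝ) := by rw [hN]; push_cast; exact h
    rw [Real.logb_lt_iff_lt_rpow (by norm_num) (by linarith), Real.rpow_natCast,
      div_lt_iff₀ hε] at h'
    exact h'
  obtain ⟨-, hVn, hVu, -⟩ := snm_mgf ℱ M hM hM0 c hc hbdd' 0 0 0 (by simp) (by norm_num)
    (by simp) Var hV0 hV n
  let S : ℕ → Set Ω := fun i => {ω | Var n ω ≤ 2 ^ (i + 1) * ε ∧
    Real.sqrt (2 * (2 ^ (i + 1) * ε) * L) + c * L ≤ |M n ω|}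
  have hS : ∀ i, μ.real (S i) ≤ 2 * δ := fun i => by
    rw [← hexp]
    exact snm_tail ℱ M hM hM0 c hc hbdd' Var hV0 hV n _ L (by positivity) hL
  have hsub : ({ω | 2 * Real.sqrt 2 * Real.sqrt (Var n ω * L) +
        2 * Real.sqrt (ε * L) + 2 * c * L ≤ |M n ω|} : Set Ω) ≤ᵐ[μ]
        (⋃ i ∈ Finset.range N, S i : Set Ω) := by
    filter_upwards [hVn, hVu] with ω h0 hu
    intro hω
    replace hω : 2 * Real.sqrt 2 * Real.sqrt (Var n ω * L) +
        2 * Real.sqrt (ε * L) + 2 * c * L ≤ |M n ω| := hω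
    have hex : ∃ i, Var n ω ≤ 2 ^ (i + 1) * ε := ⟨N - 1, by
      have : N - 1 + 1 = N := by omega
      rw [this]; linarith⟩
    classical
    set i := Nat.find hex with hi
    have hi1 : Var n ω ≤ 2 ^ (i + 1) * ε := Nat.find_spec hex
    have hiN : i < N := by
      have : i ≤ N - 1 := Nat.find_min' hex (by
        have : N - 1 + 1 = N := by omega
        rw [this]; linarith)
      omega
    have hcL : 0 < c * L := by positivity
    have hA : 0 ≤ 2 * Real.sqrt 2 * Real.sqrt (Var n ω * L) := by positivity
    have hB : 0 ≤ 2 * Real.sqrt (ε * L) := by positivity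
    have hsq : Real.sqrt (2 * (2 ^ (i + 1) * ε) * L) ≤
        2 * Real.sqrt 2 * Real.sqrt (Var n ω * L) + 2 * Real.sqrt (ε * L) := by
      rcases Nat.eq_zero_or_pos i with h | h
      · have : Real.sqrt (2 * (2 ^ (i + 1) * ε) * L) = 2 * Real.sqrt (ε * L) := by
          rw [h, show 2 * (2 ^ (0 + 1) * ε) * L = 2 ^ 2 * (ε * L) by ring,
            Real.sqrt_mul (by norm_num), Real.sqrt_sq (by norm_num)]
        linarith
      · have hm := Nat.find_min hex (m := i - 1) (by omega)
        rw [show i - 1 + 1 = i by omega, not_le] at hm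
        have e : 2 * Real.sqrt 2 * Real.sqrt (Var n ω * L) = Real.sqrt (8 * (Var n ω * L)) := by
          rw [show (8 : ℝ) * (Var n ω * L) = 2 ^ 2 * (2 * (Var n ω * L)) by ring,
            Real.sqrt_mul (x := 2 ^ 2) (by norm_num), Real.sqrt_sq (by norm_num),
            Real.sqrt_mul (x := 2) (by norm_num)]
          ring
        have : Real.sqrt (2 * (2 ^ (i + 1) * ε) * L) ≤ Real.sqrt (8 * (Var n ω * L)) := by
          apply Real.sqrt_le_sqrt
          have h5 := mul_le_mul_of_nonneg_right hm.le hL.le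
          have h6 : 0 ≤ Var n ω * L := mul_nonneg h0 hL.le
          rw [pow_succ]
          nlinarith
        linarith
    have : ω ∈ ⋃ i ∈ Finset.range N, S i := by
      simp only [Set.mem_iUnion]
      exact ⟨i, Finset.mem_range.2 hiN, hi1, by linarith⟩
    exact this
  calc _ ≤ μ.real (⋃ i ∈ Finset.range N, S i) :=
        ENNReal.toReal_mono (measure_ne_top _ _) (measure_mono_ae hsub)
    _ ≤ ∑ i ∈ Finset.range N, μ.real (S i) := measureReal_biUnion_finset_le _ _
    _ ≤ ∑ i ∈ Finset.range N, 2 * δ := Finset.sum_le_sum fun i _ => hS i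
    _ = N * (2 * δ) := by simp
    _ ≤ _ := by nlinarith
end

section
/- Consider a finite-horizon MDP (S, A, H, P, r, s₁) with r ≥ 0. For h ∈ {1,…,H+1} let Q_h : S×A → ℝ and V_h : S → ℝ satisfy V_{H+1} ≡ 0 and V_h(s) = max_a Q_h(s,a) for h ≤ H, and let β_h : S×A → ℝ be nonnegative. Assume (i) Q_h(s,a) ≥ Q*_h(s,a) for all (s,a) and all h ∈ {1,…,H} (optimism), and (ii) Q_h(s,a) − r(s,a) − P_{s,a}·V_{h+1} ≤ β_h(s,a) for all (s,a) and all h ∈ {1,…,H}. Let π be a greedy policy with respect to Q, i.e. π_h(s) ∈ argmax_a Q_h(s,a) for every (s,h). Then V*₁(s₁) − V^π₁(s₁) ≤ Σ_{h=1}^{H} Σ_{(s,a) ∈ S×A} w_h(s,a; π)·β_h(s,a). -/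
open Finset

/-- State occupancy measure (index shifted by one). -/
def stateOcc {S A : Type*} [Fintype S] [DecidableEq S] (P : S → A → S → ℝ) (s₁ : S)
    (π : ℕ → S → A) : ℕ → S → ℝ
  | 0 => fun s => if s = s₁ then 1 else 0
  | n + 1 => fun s => ∑ s', stateOcc P s₁ π n s' * P s' (π (n + 1) s') s

/-- Suboptimality decomposition: for any optimistic Q-function whose per-step Bellman
error is bounded by `β`, the greedy policy's suboptimality is bounded by the
occupancy-weighted sum of the Bellman errors. -/
theorem suboptimality_decomposition
    {S A : Type*} [Fintype S] [Fintype A] [Nonempty A] [DecidableEq S] [DecidableEq A]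
    (H : ℕ) (P : S → A → S → ℝ)
    (hP : ∀ s a, (∀ s', 0 ≤ P s a s') ∧ ∑ s', P s a s' = 1)
    (r : S → A → ℝ) (hr : ∀ s a, 0 ≤ r s a) (s₁ : S)
    -- the optimal value functions of the MDP, defined by backward recursion
    (Qstar : ℕ → S → A → ℝ) (Vstar : ℕ → S → ℝ)
    (hVstarH : ∀ s, Vstar (H + 1) s = 0)
    (hQstar : ∀ h, 1 ≤ h → h ≤ H → ∀ s a,
      Qstar h s a = r s a + ∑ s', P s a s' * Vstar (h + 1) s')
    (hVstar : ∀ h, 1 ≤ h → h ≤ H → ∀ s, Vstar h s = ⨆ a, Qstar h s a)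
    -- the candidate Q-function, its value function and the Bellman-error bounds
    (Q : ℕ → S → A → ℝ) (V : ℕ → S → ℝ)
    (hVH : ∀ s, V (H + 1) s = 0)
    (hV : ∀ h, 1 ≤ h → h ≤ H → ∀ s, V h s = ⨆ a, Q h s a)
    (β : ℕ → S → A → ℝ) (hβ : ∀ h s a, 0 ≤ β h s a)
    -- (i) optimism
    (hopt : ∀ h, 1 ≤ h → h ≤ H → ∀ s a, Qstar h s a ≤ Q h s a)
    -- (ii) Bellman-error bound
    (hbell : ∀ h, 1 ≤ h → h ≤ H → ∀ s a,
      Q h s a - r s a - ∑ s', P s a s' * V (h + 1) s' ≤ β h s a)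
    -- the greedy policy with respect to `Q`
    (π : ℕ → S → A)
    (hπ : ∀ h, 1 ≤ h → h ≤ H → ∀ s a, Q h s a ≤ Q h s (π h s))
    -- the value functions of `π`, defined by backward recursion
    (Vπ : ℕ → S → ℝ)
    (hVπH : ∀ s, Vπ (H + 1) s = 0)
    (hVπ : ∀ h, 1 ≤ h → h ≤ H → ∀ s,
      Vπ h s = r s (π h s) + ∑ s', P s (π h s) s' * Vπ (h + 1) s')
    -- the occupancy measure of `π`
    (w : ℕ → S → A → ℝ)
    (hw1 : ∀ s a, w 1 s a = if s = s₁ ∧ a = π 1 s then 1 else 0)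
    (hwrec : ∀ h, 1 ≤ h → h + 1 ≤ H → ∀ s a,
      w (h + 1) s a =
        (if a = π (h + 1) s then 1 else 0) * ∑ s', ∑ a', w h s' a' * P s' a' s) :
    Vstar 1 s₁ - Vπ 1 s₁ ≤ ∑ h ∈ Finset.Icc 1 H, ∑ s, ∑ a, w h s a * β h s a := by
  have hd0 : ∀ n s, 0 ≤ stateOcc P s₁ π n s := by
    intro n
    induction n with
    | zero => intro s; simp only [stateOcc]; split_ifs <;> norm_num
    | succ n ih =>
      intro s
      simp only [stateOcc]
      exact Finset.sum_nonneg fun s' _ => mul_nonneg (ih s') ((hP _ _).1 _)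
  have hwd : ∀ n, n + 1 ≤ H → ∀ s a,
      w (n + 1) s a = if a = π (n + 1) s then stateOcc P s₁ π n s else 0 := by
    intro n
    induction n with
    | zero =>
      intro _ s a
      simp only [stateOcc, zero_add]
      rw [hw1]
      by_cases h1 : s = s₁ <;> by_cases h2 : a = π 1 s <;> simp [h1, h2]
    | succ n ih =>
      intro hn s a
      rw [hwrec (n + 1) (by omega) hn]
      have : ∑ s', ∑ a', w (n + 1) s' a' * P s' a' s = stateOcc P s₁ π (n + 1) s := by
        simp only [stateOcc]
        refine Finset.sum_congr rfl fun s' _ => ?_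
        simp [ih (by omega)]
      rw [this]
      split_ifs <;> simp
  have hVQ : ∀ h, 1 ≤ h → h ≤ H → ∀ s, V h s ≤ Q h s (π h s) := by
    intro h h1 h2 s
    rw [hV h h1 h2]
    exact ciSup_le (hπ h h1 h2 s)
  have hstep : ∀ h, 1 ≤ h → h ≤ H → ∀ s, V h s - Vπ h s ≤
      β h s (π h s) + ∑ s', P s (π h s) s' * (V (h + 1) s' - Vπ (h + 1) s') := by
    intro h h1 h2 s
    have a1 := hVQ h h1 h2 s
    have a2 := hbell h h1 h2 s (π h s)
    have a3 := hVπ h h1 h2 s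
    simp only [mul_sub, Finset.sum_sub_distrib]
    linarith
  have key : ∀ n, n ≤ H → V 1 s₁ - Vπ 1 s₁ ≤
      ∑ i ∈ Finset.range n, ∑ s, ∑ a, w (i + 1) s a * β (i + 1) s a
        + ∑ s, stateOcc P s₁ π n s * (V (n + 1) s - Vπ (n + 1) s) := by
    intro n
    induction n with
    | zero => intro _; simp [stateOcc]
    | succ n ih =>
      intro hn
      refine (ih (by omega)).trans ?_
      rw [Finset.sum_range_succ, add_assoc]
      gcongr
      have e1 : ∑ s, ∑ a, w (n + 1) s a * β (n + 1) s a
          = ∑ s, stateOcc P s₁ π n s * β (n + 1) s (π (n + 1) s) := by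
        refine Finset.sum_congr rfl fun s _ => ?_
        simp [hwd n hn]
      have e2 : ∑ s, stateOcc P s₁ π (n + 1) s * (V (n + 1 + 1) s - Vπ (n + 1 + 1) s)
          = ∑ s, stateOcc P s₁ π n s * ∑ s', P s (π (n + 1) s) s' *
              (V (n + 1 + 1) s' - Vπ (n + 1 + 1) s') := by
        simp only [stateOcc, Finset.sum_mul, Finset.mul_sum]
        rw [Finset.sum_comm]
        simp only [mul_assoc]
      rw [e1, e2, ← Finset.sum_add_distrib]
      refine Finset.sum_le_sum fun s _ => ?_
      rw [← mul_add]
      exact mul_le_mul_of_nonneg_left (hstep (n + 1) (by omega) hn s) (hd0 n s)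
  have hle : Vstar 1 s₁ ≤ V 1 s₁ := by
    rcases Nat.eq_zero_or_pos H with h0 | h0
    · subst h0
      have a1 := hVstarH s₁
      have a2 := hVH s₁
      simp only [zero_add] at a1 a2
      rw [a1, a2]
    · rw [hVstar 1 le_rfl h0, hV 1 le_rfl h0]
      exact ciSup_mono (Set.finite_range _).bddAbove (hopt 1 le_rfl h0 s₁)
  have hk := key H le_rfl
  simp only [hVH, hVπH, sub_self, mul_zero, Finset.sum_const_zero, add_zero] at hk
  have e : ∑ h ∈ Finset.Icc 1 H, ∑ s, ∑ a, w h s a * β h s a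
      = ∑ i ∈ Finset.range H, ∑ s, ∑ a, w (i + 1) s a * β (i + 1) s a := by
    rw [Finset.range_eq_Ico, Finset.sum_Ico_add' (fun h => ∑ s, ∑ a, w h s a * β h s a) 0 H 1]
    rfl
  rw [e]
  linarith
end

section
/- Consider a finite-horizon MDP (S, A, H, P, r, s₁) with r ≥ 0, let π be a deterministic policy, let B > 0, and for h ∈ {1,…,H+1} let V_h : S → ℝ satisfy 0 ≤ V_h(s) ≤ B for all s and V_{H+1} ≡ 0. Let β_h : S×A → ℝ be nonnegative and assume V_h(s) ≤ r(s,π_h(s)) + P_{s,π_h(s)}·V_{h+1} + β_h(s,π_h(s)) for every state s and every h ∈ {1,…,H}. Then Σ_{h=1}^{H} Σ_{(s,a) ∈ S×A} w_h(s,a; π)·𝕍(P_{s,a}, V_{h+1}) ≤ 2B·Σ_{h=1}^{H} Σ_{(s,a) ∈ S×A} w_h(s,a; π)·( r(s,a) + β_h(s,a) ). -/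
open Finset

/-- `𝕍(p,v) = Σᵢ pᵢ vᵢ² − (p·v)²`. -/
def pVar {S : Type*} [Fintype S] (p v : S → ℝ) : ℝ :=
  (∑ s, p s * v s ^ 2) - (∑ s, p s * v s) ^ 2

/-- Total-variance telescoping bound: for nonnegative value functions bounded by `B`
that approximately satisfy the Bellman inequality along `π` up to slack `β`, the
occupancy-weighted sum of one-step transition variances of the value functions is at
most `2B` times the occupancy-weighted sum of rewards plus slacks. -/
theorem total_variance_bound
    {S A : Type*} [Fintype S] [Fintype A] [Nonempty A] [DecidableEq S] [DecidableEq A]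
    (H : ℕ) (P : S → A → S → ℝ)
    (hP : ∀ s a, (∀ s', 0 ≤ P s a s') ∧ ∑ s', P s a s' = 1)
    (r : S → A → ℝ) (hr : ∀ s a, 0 ≤ r s a) (s₁ : S)
    -- the deterministic policy
    (π : ℕ → S → A)
    -- the value functions, bounded in `[0, B]`
    (B : ℝ) (hB : 0 < B)
    (V : ℕ → S → ℝ)
    (hVbd : ∀ h, 1 ≤ h → h ≤ H + 1 → ∀ s, 0 ≤ V h s ∧ V h s ≤ B)
    (hVH : ∀ s, V (H + 1) s = 0)
    -- the slacks and the approximate Bellman inequality along `π`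
    (β : ℕ → S → A → ℝ) (hβ : ∀ h s a, 0 ≤ β h s a)
    (hbell : ∀ h, 1 ≤ h → h ≤ H → ∀ s,
      V h s ≤ r s (π h s) + (∑ s', P s (π h s) s' * V (h + 1) s') + β h s (π h s))
    -- the occupancy measure of `π`
    (w : ℕ → S → A → ℝ)
    (hw1 : ∀ s a, w 1 s a = if s = s₁ ∧ a = π 1 s then 1 else 0)
    (hwrec : ∀ h, 1 ≤ h → h + 1 ≤ H → ∀ s a,
      w (h + 1) s a =
        (if a = π (h + 1) s then 1 else 0) * ∑ s', ∑ a', w h s' a' * P s' a' s) :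
    ∑ h ∈ Finset.Icc 1 H, ∑ s, ∑ a, w h s a * pVar (P s a) (V (h + 1)) ≤
      2 * B * ∑ h ∈ Finset.Icc 1 H, ∑ s, ∑ a, w h s a * (r s a + β h s a) := by
  have hprop : ∀ n, n + 1 ≤ H → ∀ s a, 0 ≤ w (n + 1) s a ∧ (a ≠ π (n + 1) s → w (n + 1) s a = 0) := by
    intro n
    induction n with
    | zero =>
      intro _ s a
      simp only [zero_add]
      rw [hw1]
      refine ⟨by split_ifs <;> norm_num, fun h => ?_⟩
      rw [if_neg (fun hh => h hh.2)]
    | succ n ih =>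
      intro hn s a
      rw [hwrec (n + 1) (by omega) hn]
      refine ⟨mul_nonneg (by split_ifs <;> norm_num) ?_, fun h => by rw [if_neg h, zero_mul]⟩
      exact Finset.sum_nonneg fun s' _ => Finset.sum_nonneg fun a' _ =>
        mul_nonneg (ih (by omega) s' a').1 ((hP s' a').1 s)
  have hstep : ∀ n, n + 1 ≤ H →
      ∑ s, ∑ a, w (n + 1) s a * pVar (P s a) (V (n + 1 + 1)) ≤
        2 * B * (∑ s, ∑ a, w (n + 1) s a * (r s a + β (n + 1) s a))
        + (∑ s, ∑ a, w (n + 1) s a * ∑ s', P s a s' * V (n + 1 + 1) s' ^ 2)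
        - ∑ s, ∑ a, w (n + 1) s a * V (n + 1) s ^ 2 := by
    intro n hn
    rw [Finset.mul_sum, ← Finset.sum_add_distrib, ← Finset.sum_sub_distrib]
    refine Finset.sum_le_sum fun s _ => ?_
    rw [Finset.mul_sum, ← Finset.sum_add_distrib, ← Finset.sum_sub_distrib]
    refine Finset.sum_le_sum fun a _ => ?_
    by_cases ha : a = π (n + 1) s
    · have hb := hbell (n + 1) (by omega) hn s
      rw [← ha] at hb
      have h0 := (hprop n hn s a).1
      have hV := hVbd (n + 1) (by omega) (by omega) s
      have hV' := hVbd (n + 1 + 1) (by omega) (by omega)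
      have hp0 : 0 ≤ ∑ s', P s a s' * V (n + 1 + 1) s' :=
        Finset.sum_nonneg fun s' _ => mul_nonneg ((hP s a).1 s') (hV' s').1
      have hp1 : ∑ s', P s a s' * V (n + 1 + 1) s' ≤ B := by
        calc _ ≤ ∑ s', P s a s' * B :=
              Finset.sum_le_sum fun s' _ => mul_le_mul_of_nonneg_left (hV' s').2 ((hP s a).1 s')
          _ = B := by rw [← Finset.sum_mul, (hP s a).2, one_mul]
      have hr0 := hr s a
      have hβ0 := hβ (n + 1) s a
      have key : pVar (P s a) (V (n + 1 + 1)) ≤ 2 * B * (r s a + β (n + 1) s a)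
          + (∑ s', P s a s' * V (n + 1 + 1) s' ^ 2) - V (n + 1) s ^ 2 := by
        unfold pVar
        generalize (∑ s', P s a s' * V (n + 1 + 1) s') = p at *
        have h1 := mul_nonneg (sub_nonneg.2 hb) (add_nonneg hV.1 hp0)
        have h2 := mul_nonneg (add_nonneg hr0 hβ0)
          (by linarith [hV.2] : 0 ≤ 2 * B - (V (n + 1) s + p))
        nlinarith
      have := mul_le_mul_of_nonneg_left key h0
      linarith
    · rw [(hprop n hn s a).2 ha]; simp
  have htel : ∀ n, n + 1 + 1 ≤ H →
      ∑ s, ∑ a, w (n + 1 + 1) s a * V (n + 1 + 1) s ^ 2 =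
      ∑ s, ∑ a, w (n + 1) s a * ∑ s', P s a s' * V (n + 1 + 1) s' ^ 2 := by
    intro n hn
    have h1 : ∀ s, ∑ a, w (n + 1 + 1) s a * V (n + 1 + 1) s ^ 2 =
        ∑ s', ∑ a', w (n + 1) s' a' * (P s' a' s * V (n + 1 + 1) s ^ 2) := by
      intro s
      simp only [hwrec (n + 1) (by omega) hn, ← mul_assoc, ← Finset.sum_mul]
      simp
    simp only [h1, Finset.mul_sum]
    rw [Finset.sum_comm]
    exact Finset.sum_congr rfl fun s' _ => Finset.sum_comm
  have hmain : ∀ n, n + 1 ≤ H →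
      ∑ h ∈ Finset.Icc 1 (n + 1), ∑ s, ∑ a, w h s a * pVar (P s a) (V (h + 1)) ≤
      2 * B * (∑ h ∈ Finset.Icc 1 (n + 1), ∑ s, ∑ a, w h s a * (r s a + β h s a))
        + (∑ s, ∑ a, w (n + 1) s a * ∑ s', P s a s' * V (n + 1 + 1) s' ^ 2) := by
    intro n
    induction n with
    | zero =>
      intro hn
      have := hstep 0 hn
      have h2 : 0 ≤ ∑ s, ∑ a, w (0 + 1) s a * V (0 + 1) s ^ 2 :=
        Finset.sum_nonneg fun s _ => Finset.sum_nonneg fun a _ =>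
          mul_nonneg (hprop 0 hn s a).1 (sq_nonneg _)
      simp only [zero_add, Finset.Icc_self, Finset.sum_singleton] at *
      linarith
    | succ n ih =>
      intro hn
      have h1 := hstep (n + 1) hn
      have h2 := ih (by omega)
      have h3 := htel n hn
      have e : ∀ f : ℕ → ℝ, ∑ h ∈ Finset.Icc 1 (n + 1 + 1), f h =
          ∑ h ∈ Finset.Icc 1 (n + 1), f h + f (n + 1 + 1) :=
        fun f => Finset.sum_Icc_succ_top (by omega) f
      rw [e, e, mul_add]
      linarith
  rcases H with _ | n
  · simp
  · have := hmain n le_rfl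
    simpa [hVH] using this
end
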